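/- arXiv:math/0503029 — 4 statements merged into one kernel-verified Lean document; each statement's English description precedes it below -/
import Mathlib

section
/- For a finite poset (I,⪯), define the Λ-multilinear operation P_{(I,⪯)} : A(𝒜,Λ,χ)^I → A(𝒜,Λ,χ) on basis elements by P_{(I,⪯)}(a^{α_i} : i ∈ I) = (Π_{i,j ∈ I, i ≠ j, i ⪯ j} ℓ^{−χ(α_j,α_i)}) · a^{Σ_{i∈I} α_i}, extended multilinearly. Let (J,≲) and (K,⊴) be nonempty finite posets with J ∩ K = ∅, let l ∈ K, set I = J ∪ (K ∖ {l}), and define the partial order ⪯ on I by: i ⪯ j if and only if (i, j ∈ J and i ≲ j), or (i, j ∈ K∖{l} and i ⊴ j), or (i ∈ J, j ∈ K∖{l} and l ⊴ j), or (i ∈ K∖{l}, j ∈ J and i ⊴ l). Then for all f_j ∈ A(𝒜,Λ,χ), j ∈ J, and g_k ∈ A(𝒜,Λ,χ), k ∈ K∖{l}, one has P_{(I,⪯)}(f_j : j ∈ J; g_k : k ∈ K∖{l}) = P_{(K,⊴)}(h_k : k ∈ K), where h_l = P_{(J,≲)}(f_j : j ∈ J) and h_k = g_k for k ∈ K∖{l}.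 -/
open Classical Function

noncomputable section

variable {G : Type} [AddCommGroup G] {Λ : Type} [CommRing Λ] [Algebra ℚ Λ]
  {Ω : Type} [CommRing Ω] [Algebra ℚ Ω]

/-- The multilinear operation `P_{(I,⪯)}` on `A(𝒜,Λ,χ)` attached to a finite set `I`
with relation `r = ⪯`, defined on basis elements by
`P(a^{α_i} : i ∈ I) = (∏_{i ≠ j, i ⪯ j} ℓ^{-χ(α_j,α_i)}) a^{∑ α_i}`
and extended multilinearly. -/
def PA (Cbar : AddSubmonoid G) (χ : G → G → ℤ) (l : Λˣ)
    {I : Type} [Fintype I] (r : I → I → Prop)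
    (f : I → (↥Cbar →₀ Λ)) : ↥Cbar →₀ Λ :=
  ∑ α ∈ Fintype.piFinset (fun i => (f i).support),
    Finsupp.single (∑ i, α i)
      ((∏ i, f i (α i)) *
        ∏ q ∈ Finset.univ.filter (fun q : I × I => q.1 ≠ q.2 ∧ r q.1 q.2),
          ((l ^ (-χ ((α q.2 : G)) ((α q.1 : G))) : Λˣ) : Λ))
/-- The partial order `⪯` on `I = J ⊔ (K ∖ {k₀})` obtained by substituting the poset
`(J,≲)` into the poset `(K,⊴)` at the element `k₀ ∈ K`. -/
def combRel {J K : Type} (rJ : J → J → Prop) (rK : K → K → Prop) (k₀ : K) :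
    J ⊕ {k : K // k ≠ k₀} → J ⊕ {k : K // k ≠ k₀} → Prop
  | Sum.inl i, Sum.inl j => rJ i j
  | Sum.inr i, Sum.inr j => rK (i : K) (j : K)
  | Sum.inl _, Sum.inr j => rK k₀ (j : K)
  | Sum.inr i, Sum.inl _ => rK (i : K) k₀
theorem prod_sum_combRel {M : Type*} [CommMonoid M] {A : Type*} [AddCommMonoid A]
    (c : A → A → M)
    (hl₀ : ∀ b, c 0 b = 1) (hl : ∀ a a' b, c (a + a') b = c a b * c a' b)
    (hr₀ : ∀ b, c b 0 = 1) (hr : ∀ b a a', c b (a + a') = c b a * c b a')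
    {J K : Type} [Fintype J] [Fintype K] (rJ : J → J → Prop) (rK : K → K → Prop) (k₀ : K)
    (α : J → A) (β : {k : K // k ≠ k₀} → A) (γ : K → A)
    (h₀ : γ k₀ = ∑ j, α j) (hγ : ∀ k : {k : K // k ≠ k₀}, γ k = β k) :
    (∏ q ∈ Finset.univ.filter
        (fun q : (J ⊕ {k : K // k ≠ k₀}) × (J ⊕ {k : K // k ≠ k₀}) =>
          q.1 ≠ q.2 ∧ combRel rJ rK k₀ q.1 q.2),
        c (Sum.elim α β q.1) (Sum.elim α β q.2))
      = (∏ q ∈ Finset.univ.filter (fun q : J × J => q.1 ≠ q.2 ∧ rJ q.1 q.2),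
          c (α q.1) (α q.2))
        * ∏ q ∈ Finset.univ.filter (fun q : K × K => q.1 ≠ q.2 ∧ rK q.1 q.2),
          c (γ q.1) (γ q.2) := by
  have hsuml : ∀ b, c (∑ j, α j) b = ∏ j, c (α j) b := fun b =>
    map_sum (⟨⟨fun a => Additive.ofMul (c a b), hl₀ b⟩, fun a a' => hl a a' b⟩ :
      A →+ Additive M) α Finset.univ
  have hsumr : ∀ b, c b (∑ j, α j) = ∏ j, c b (α j) := fun b =>
    map_sum (⟨⟨fun a => Additive.ofMul (c b a), hr₀ b⟩, fun a a' => hr b a a'⟩ :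
      A →+ Additive M) α Finset.univ
  have hsplit : ∀ F : K → M, ∏ k, F k = F k₀ * ∏ k : {k : K // k ≠ k₀}, F k := fun F => by
    rw [Fintype.prod_eq_mul_prod_subtype_ne F k₀]
  have hne : ∀ k : {k : K // k ≠ k₀}, ¬ k₀ = (k : K) := fun k h => k.2 h.symm
  have hne' : ∀ k : {k : K // k ≠ k₀}, ¬ (k : K) = k₀ := fun k => k.2
  have hite : ∀ (p : Prop) [Decidable p] (F : J → M),
      (if p then ∏ j, F j else 1) = ∏ j, if p then F j else 1 := fun p _ F => by
    split_ifs <;> simp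
  have hLL : ∀ i j : J, combRel rJ rK k₀ (Sum.inl i) (Sum.inl j) ↔ rJ i j :=
    fun _ _ => Iff.rfl
  have hRR : ∀ i j, combRel rJ rK k₀ (Sum.inr i) (Sum.inr j) ↔ rK i j := fun _ _ => Iff.rfl
  have hLR : ∀ i j, combRel rJ rK k₀ (Sum.inl i) (Sum.inr j) ↔ rK k₀ j := fun _ _ => Iff.rfl
  have hRL : ∀ i j, combRel rJ rK k₀ (Sum.inr i) (Sum.inl j) ↔ rK i k₀ := fun _ _ => Iff.rfl
  rw [Finset.prod_filter, Finset.prod_filter, Finset.prod_filter]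
  simp only [Fintype.prod_prod_type, Fintype.prod_sum_type, hsplit,
    Sum.elim_inl, Sum.elim_inr, hLL, hRR, hLR, hRL, h₀, hγ, hne, hne', hsuml, hsumr, ne_eq,
    not_true_eq_false, false_and, if_false, not_false_eq_true, true_and,
    Sum.inl.injEq, Sum.inr.injEq, reduceCtorEq, Finset.prod_mul_distrib, Subtype.ext_iff, hite]
  rw [Finset.prod_comm (s := (Finset.univ : Finset J))
    (t := (Finset.univ : Finset {k : K // k ≠ k₀}))]
  simp only [mul_assoc, Finset.prod_const_one, one_mul]
  exact congrArg _ (mul_left_comm _ _ _)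

theorem statement2
    (Cbar : AddSubmonoid G)
    (hC : ∀ x ∈ Cbar, ∀ y ∈ Cbar, x + y = 0 → x = 0 ∧ y = 0)
    (χ : G → G → ℤ)
    (hχ₁ : ∀ x y z : G, χ (x + y) z = χ x z + χ y z)
    (hχ₂ : ∀ x y z : G, χ x (y + z) = χ x y + χ x z)
    (l : Λˣ) (hl : ∀ k : ℕ, 0 < k → IsUnit ((l : Λ) ^ k - 1))
    {J K : Type} [Fintype J] [Fintype K] [Nonempty J] [Nonempty K]
    [PartialOrder J] [PartialOrder K] (k₀ : K)
    (f : J → (↥Cbar →₀ Λ)) (g : {k : K // k ≠ k₀} → (↥Cbar →₀ Λ)) :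
    PA Cbar χ l (combRel (· ≤ · : J → J → Prop) (· ≤ · : K → K → Prop) k₀) (Sum.elim f g)
      = PA Cbar χ l (· ≤ · : K → K → Prop)
          (fun k => if h : k = k₀ then PA Cbar χ l (· ≤ · : J → J → Prop) f else g ⟨k, h⟩) := by
  have hz₁ : ∀ z, χ 0 z = 0 := fun z => by simpa using hχ₁ 0 0 z
  have hz₂ : ∀ z, χ z 0 = 0 := fun z => by simpa using hχ₂ z 0 0
  have hw := fun α β γ => prod_sum_combRel
    (fun a b : Cbar => ((l ^ (-χ (b : G) (a : G)) : Λˣ) : Λ))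
    (by simp [hz₂]) (by intro a a' b; simp [hχ₂, zpow_add, mul_comm])
    (by simp [hz₁]) (by intro b a a'; simp [hχ₁, zpow_add, mul_comm])
    (· ≤ · : J → J → Prop) (· ≤ · : K → K → Prop) k₀ α β γ
  set h : K → (↥Cbar →₀ Λ) :=
    fun k => if h : k = k₀ then PA Cbar χ l (· ≤ · : J → J → Prop) f else g ⟨k, h⟩ with hh
  have hk₀ : h k₀ = PA Cbar χ l (· ≤ · : J → J → Prop) f := by simp [hh]
  have hk : ∀ k : {k : K // k ≠ k₀}, h k = g k := fun k => by simp [hh, k.2]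
  let w : (K → Cbar) → Λ := fun γ =>
    ∏ q ∈ Finset.univ.filter (fun q : K × K => q.1 ≠ q.2 ∧ q.1 ≤ q.2),
      ((l ^ (-χ (γ q.2 : G) (γ q.1 : G)) : Λˣ) : Λ)
  let e := Equiv.piSplitAt k₀ (fun _ => (Cbar : Type))
  have he₀ : ∀ p, e.symm p k₀ = p.1 := fun p => by simp [e, Equiv.piSplitAt]
  have he : ∀ p (k : {k : K // k ≠ k₀}), e.symm p k = p.2 k := fun p k => by
    simp [e, Equiv.piSplitAt, k.2]
  have hR : PA Cbar χ l (· ≤ · : K → K → Prop) h =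
      ∑ β ∈ Fintype.piFinset (fun k => (g k).support),
        (PA Cbar χ l (· ≤ · : J → J → Prop) f).sum fun a c =>
          Finsupp.single (a + ∑ k, β k) (c * ((∏ k, g k (β k)) * w (e.symm (a, β)))) := by
    simp only [Finsupp.sum]
    rw [← Finset.sum_product', PA, ← hk₀]
    refine Finset.sum_equiv (e.trans (Equiv.prodComm _ _)) (fun γ => ?_) fun γ _ => ?_
    · simp only [Fintype.mem_piFinset, Finset.mem_product, ← hk]
      refine ⟨fun H => ⟨fun k => H k, H k₀⟩, fun H k => ?_⟩
      by_cases hkk : k = k₀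
      · exact hkk ▸ H.2
      · exact H.1 ⟨k, hkk⟩
    · rw [Fintype.sum_eq_add_sum_subtype_ne _ k₀,
        Fintype.prod_eq_mul_prod_subtype_ne (fun i => h i (γ i)) k₀, mul_assoc]
      have : w (e.symm (e γ)) = w γ := by rw [e.symm_apply_apply]
      simp only [hk]
      exact congrArg (fun x => Finsupp.single (γ k₀ + ∑ k : {k // k ≠ k₀}, γ k)
        (h k₀ (γ k₀) * ((∏ k : {k // k ≠ k₀}, g k (γ k)) * x))) this.symm
  have hL : PA Cbar χ l (combRel (· ≤ · : J → J → Prop) (· ≤ · : K → K → Prop) k₀)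
      (Sum.elim f g) =
      ∑ β ∈ Fintype.piFinset (fun k => (g k).support),
        ∑ α ∈ Fintype.piFinset (fun j => (f j).support),
          Finsupp.single (∑ j, α j + ∑ k, β k)
            (((∏ j, f j (α j)) *
              ∏ q ∈ Finset.univ.filter (fun q : J × J => q.1 ≠ q.2 ∧ q.1 ≤ q.2),
                ((l ^ (-χ (α q.2 : G) (α q.1 : G)) : Λˣ) : Λ)) *
              ((∏ k, g k (β k)) * w (e.symm (∑ j, α j, β)))) := by
    rw [← Finset.sum_product', PA]
    refine Finset.sum_equiv ((Equiv.sumPiEquivProdPi _).trans (Equiv.prodComm _ _))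
      (fun γ => ?_) fun γ _ => ?_
    · simp [Fintype.mem_piFinset, and_comm]
    · obtain ⟨⟨α, β⟩, rfl⟩ := (Equiv.sumPiEquivProdPi _).symm.surjective γ
      have hγ : (Equiv.sumPiEquivProdPi fun _ => (Cbar : Type)).symm (α, β) = Sum.elim α β := by
        ext (_ | _) <;> rfl
      have hw' := hw α β (e.symm (∑ j, α j, β)) (he₀ _) (he _)
      rw [hγ]
      simp only [Fintype.sum_sum_type, Fintype.prod_sum_type, Sum.elim_inl, Sum.elim_inr]
      refine Eq.trans ?_ (congrArg (Finsupp.single (∑ j, α j + ∑ k, β k))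
        ((congrArg (((∏ j, f j (α j)) * ∏ k, g k (β k)) * ·) hw').trans
          (mul_mul_mul_comm _ _ _ _)))
      congr!
  rw [hL, hR]
  refine Finset.sum_congr rfl fun β _ => ?_
  rw [PA, ← Finsupp.sum_finsetSum_index]
  · exact Finset.sum_congr rfl fun α _ => by
      rw [Finsupp.sum_single_index (by rw [zero_mul, Finsupp.single_zero])]
  · simp
  · intro a b c
    rw [add_mul, Finsupp.single_add]

end
end

section
/- The multiplication ⋆ on B(𝒜,Λ,χ) defined by equation (6.14) is associative, and the basis element b_{[∅,∅]} indexed by the class of the empty pair is a two-sided identity; thus B(𝒜,Λ,χ) is an associative unital Λ-algebra. -/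
open Classical Function

noncomputable section

variable {G : Type} [AddCommGroup G] {Λ : Type} [CommRing Λ] [Algebra ℚ Λ]
  {Ω : Type} [CommRing Ω] [Algebra ℚ Ω]

/-- The "positive cone" `C(𝒜) = C̄(𝒜) ∖ {0}` as a subtype of `K(𝒜)`. -/
abbrev Cpos (Cbar : AddSubmonoid G) : Type := {x : G // x ∈ Cbar ∧ x ≠ 0}
theorem sum_mem_ne_zero {Cbar : AddSubmonoid G}
    (hC : ∀ x ∈ Cbar, ∀ y ∈ Cbar, x + y = 0 → x = 0 ∧ y = 0)
    {ι : Type} (s : Finset ι) (f : ι → G) :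
    s.Nonempty → (∀ i ∈ s, f i ∈ Cbar) → (∀ i ∈ s, f i ≠ 0) →
      (∑ i ∈ s, f i) ∈ Cbar ∧ (∑ i ∈ s, f i) ≠ 0 := by
  induction s using Finset.cons_induction with
  | empty => intro hs _ _; simp at hs
  | cons a s ha ih =>
    intro _ h1 h2
    rw [Finset.sum_cons]
    rcases s.eq_empty_or_nonempty with rfl | hs'
    · simpa using ⟨h1 a (by simp), h2 a (by simp)⟩
    · have ihs := ih hs' (fun i hi => h1 i (Finset.mem_cons_of_mem hi))
        (fun i hi => h2 i (Finset.mem_cons_of_mem hi))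
      exact ⟨Cbar.add_mem (h1 a (by simp)) ihs.1,
        fun h0 => h2 a (by simp) ((hC _ (h1 a (by simp)) _ ihs.1 h0).1)⟩
/-- The sum of two elements of the positive cone `C(𝒜)`. -/
def addC {Cbar : AddSubmonoid G}
    (hC : ∀ x ∈ Cbar, ∀ y ∈ Cbar, x + y = 0 → x = 0 ∧ y = 0)
    (α β : Cpos Cbar) : Cpos Cbar :=
  ⟨(α : G) + (β : G), Cbar.add_mem α.2.1 β.2.1,
    fun h => α.2.2 ((hC _ α.2.1 _ β.2.1 h).1)⟩
/-- A representative `(Fin (card m), κ)` of the equivalence class `[I,κ]`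
corresponding to the multiset `m` of elements of `C(𝒜)`. -/
def repF {Cbar : AddSubmonoid G} (m : Multiset (Cpos Cbar)) :
    Fin (Multiset.card m) → Cpos Cbar :=
  fun i => m.toList.get (Fin.cast (Multiset.length_toList m).symm i)
/-- `|Aut(K,μ)|`, the number of bijections `ι : K → K` with `μ ∘ ι = μ`. -/
def autCard {Cbar : AddSubmonoid G} {n : ℕ} (μ : Fin n → Cpos Cbar) : ℕ :=
  Nat.card {σ : Equiv.Perm (Fin n) // μ ∘ σ = μ}
/-- The coefficient of `b_{[K,μ]}` in `b_{[I,κ]} ⋆ b_{[J,λ]}`, as given by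
equation (6.14) of the paper. -/
def coeff614 {Cbar : AddSubmonoid G} (χ : G → G → ℤ) (l u : Λˣ) {a b c : ℕ}
    (κ : Fin a → Cpos Cbar) (lam : Fin b → Cpos Cbar) (μ : Fin c → Cpos Cbar) : Λ :=
  ((u ^ ((c : ℤ) - (a : ℤ) - (b : ℤ)) : Λˣ) : Λ) *
    algebraMap ℚ Λ ((autCard μ : ℚ))⁻¹ *
    ∑ n ∈ Finset.range (a + b + 1),
      algebraMap ℚ Λ ((-1 : ℚ) ^ (n + c) / (n.factorial : ℚ)) *
        ∑ t ∈ Finset.univ.filter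
            (fun t : (Fin a → Fin n) × (Fin b → Fin n) × (Fin n → Fin c) =>
              Function.Surjective (Sum.elim t.1 t.2.1) ∧
              Function.Surjective t.2.2 ∧
              ∀ k : Fin c,
                (μ k : G) =
                  (∑ i ∈ Finset.univ.filter (fun i : Fin a => t.2.2 (t.1 i) = k),
                    ((κ i : G))) +
                  ∑ j ∈ Finset.univ.filter (fun j : Fin b => t.2.2 (t.2.1 j) = k),
                    ((lam j : G))),
          algebraMap ℚ Λ
              (∏ k : Fin c,
                (((Finset.univ.filter (fun x : Fin n => t.2.2 x = k)).card - 1).factorial : ℚ)) *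
            ∏ q ∈ Finset.univ.filter (fun q : Fin a × Fin b => t.1 q.1 = t.2.1 q.2),
              ((l ^ (-χ ((lam q.2 : G)) ((κ q.1 : G))) : Λˣ) : Λ)
/-- The element `μ(k) = κ(η⁻¹(k)) + λ(ζ⁻¹(k))` of `C(𝒜)` determined by a
surjective map `ρ = η ⊔ ζ : I ⊔ J → K`. -/
def targetμ {Cbar : AddSubmonoid G}
    (hC : ∀ x ∈ Cbar, ∀ y ∈ Cbar, x + y = 0 → x = 0 ∧ y = 0)
    {a b c : ℕ} (κ : Fin a → Cpos Cbar) (lam : Fin b → Cpos Cbar)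
    {ρ : Fin a ⊕ Fin b → Fin c} (hρ : Function.Surjective ρ) (k : Fin c) :
    Cpos Cbar :=
  ⟨∑ x ∈ Finset.univ.filter (fun x => ρ x = k),
      Sum.elim (fun i => ((κ i : G))) (fun j => ((lam j : G))) x,
    sum_mem_ne_zero hC (Finset.univ.filter (fun x => ρ x = k))
      (Sum.elim (fun i => ((κ i : G))) (fun j => ((lam j : G))))
      (by obtain ⟨x, hx⟩ := hρ k; exact ⟨x, by simp [hx]⟩)
      (by rintro (i | j) _
          · exact (κ i).2.1
          · exact (lam j).2.1)
      (by rintro (i | j) _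
          · exact (κ i).2.2
          · exact (lam j).2.2)⟩
/-- The finite set of all equivalence classes `[K,μ]` (encoded as multisets) which can
occur in the product `b_{[I,κ]} ⋆ b_{[J,λ]}`. -/
def candidatesB {Cbar : AddSubmonoid G}
    (hC : ∀ x ∈ Cbar, ∀ y ∈ Cbar, x + y = 0 → x = 0 ∧ y = 0)
    {a b : ℕ} (κ : Fin a → Cpos Cbar) (lam : Fin b → Cpos Cbar) :
    Finset (Multiset (Cpos Cbar)) :=
  (Finset.range (a + b + 1)).biUnion fun c =>
    Finset.image
      (fun ρ : {ρ : Fin a ⊕ Fin b → Fin c // Function.Surjective ρ} =>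
        Multiset.map (targetμ hC κ lam ρ.2) Finset.univ.val)
      Finset.univ
/-- The multiplication `⋆` of equation (6.14) on `B(𝒜,Λ,χ)`, the free `Λ`-module with
basis `b_{[I,κ]}` indexed by the equivalence classes `[I,κ]` (equivalently, by finite
multisets of elements of `C(𝒜)`). -/
def mulB {Cbar : AddSubmonoid G} (χ : G → G → ℤ) (l u : Λˣ)
    (hC : ∀ x ∈ Cbar, ∀ y ∈ Cbar, x + y = 0 → x = 0 ∧ y = 0)
    (f g : Multiset (Cpos Cbar) →₀ Λ) : Multiset (Cpos Cbar) →₀ Λ :=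
  f.sum fun m₁ x =>
    g.sum fun m₂ y =>
      ∑ m₃ ∈ candidatesB hC (repF m₁) (repF m₂),
        Finsupp.single m₃ (x * y * coeff614 χ l u (repF m₁) (repF m₂) (repF m₃))
set_option linter.unusedSectionVars false

/-- Exponential weights of the logarithm `log (1 + z)`. -/
def logWeight (s : ℕ) : ℚ := if s = 0 then 0 else (-1) ^ (s + 1) * ((s - 1).factorial : ℚ)

theorem logWeight_succ (s : ℕ) :
    logWeight (s + 1) = (if s = 0 then 1 else 0) - s * logWeight s := by
  cases s with
  | zero => simp [logWeight]
  | succ s => simp [logWeight, Nat.factorial_succ]; ring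

/-- The product of the weights of the sizes of the fibres of `θ`. -/
def fiberWeight {n c : ℕ} (θ : Fin n → Fin c) : ℚ :=
  ∏ k, logWeight (Finset.univ.filter (fun i => θ i = k)).card

theorem card_filter_cons {n c : ℕ} (k : Fin c) (θ : Fin n → Fin c) (j : Fin c) :
    (Finset.univ.filter (fun i => (Fin.cons k θ : Fin (n + 1) → Fin c) i = j)).card =
      (Finset.univ.filter (fun i => θ i = j)).card + if k = j then 1 else 0 := by
  rw [Fin.card_filter_univ_succ]
  simp only [Fin.cons_zero, Fin.cons_succ]
  split_ifs <;> rfl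

theorem fiberWeight_cons {n c : ℕ} (k : Fin c) (θ : Fin n → Fin c) :
    fiberWeight (Fin.cons k θ : Fin (n + 1) → Fin c) =
      (if ∀ i, θ i ≠ k then
        ∏ j ∈ Finset.univ.erase k, logWeight (Finset.univ.filter (fun i => θ i = j)).card else 0)
      - (Finset.univ.filter (fun i => θ i = k)).card * fiberWeight θ := by
  unfold fiberWeight
  rw [← Finset.mul_prod_erase _ _ (Finset.mem_univ k),
    ← Finset.mul_prod_erase (a := k) _ (fun j => logWeight (Finset.univ.filter (fun i => θ i = j)).card)
      (Finset.mem_univ k)]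
  have h : ∀ j ∈ Finset.univ.erase k,
      logWeight (Finset.univ.filter
        (fun i => (Fin.cons k θ : Fin (n + 1) → Fin c) i = j)).card =
      logWeight (Finset.univ.filter (fun i => θ i = j)).card := by
    intro j hj
    rw [card_filter_cons, if_neg (Finset.ne_of_mem_erase hj).symm, add_zero]
  rw [Finset.prod_congr rfl h, card_filter_cons, if_pos rfl, logWeight_succ, sub_mul]
  congr 1
  · simp [Finset.filter_eq_empty_iff]
  · ring

theorem fiberWeight_succAbove {n c : ℕ} (k : Fin (c + 1)) (θ : Fin n → Fin c) :
    ∏ j ∈ Finset.univ.erase k,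
      logWeight (Finset.univ.filter (fun i => k.succAbove (θ i) = j)).card = fiberWeight θ := by
  have : Finset.univ.erase k = Finset.univ.map (Fin.succAboveEmb k) := by
    ext j
    simp [Fin.exists_succAbove_eq_iff]
  rw [this, Finset.prod_map]
  simp [fiberWeight]

section Factorizations

variable {X : Type} [Fintype X]

/-- The weighted count of factorizations of `q` through `Fin c`. -/
def factorSum {n : ℕ} (c : ℕ) (q : Fin n → X) : ℚ :=
  ∑ θ : Fin n → Fin c, ∑ h : Fin c → X, if h ∘ θ = q then fiberWeight θ else 0

theorem factorSum_succ_zero {n : ℕ} (q : Fin (n + 1) → X) : factorSum 0 q = 0 := by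
  simp [factorSum]

theorem sum_avoiding {n c : ℕ} (k : Fin (c + 1)) (x : X) (q : Fin n → X) :
    (∑ θ : Fin n → Fin (c + 1), ∑ h : Fin (c + 1) → X,
      if h k = x ∧ h ∘ θ = q then
        (if ∀ i, θ i ≠ k then ∏ j ∈ Finset.univ.erase k,
          logWeight (Finset.univ.filter (fun i => θ i = j)).card else 0) else 0) =
      factorSum c q := by
  have h1 : ∀ θ : Fin n → Fin (c + 1), θ ∉ Set.range (fun θ' : Fin n → Fin c => k.succAbove ∘ θ') →
      ¬ ∀ i, θ i ≠ k := by
    rintro θ hθ hk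
    choose θ' hθ' using fun i => Fin.exists_succAbove_eq (hk i)
    exact hθ ⟨θ', funext hθ'⟩
  have hinj : Function.Injective (fun θ' : Fin n → Fin c => k.succAbove ∘ θ') :=
    (Fin.succAbove_right_injective (p := k)).comp_left
  rw [factorSum]
  symm
  apply Finset.sum_of_injOn _ hinj.injOn (by simp)
  · intro θ _ hθ
    have := h1 θ (by simpa using hθ)
    simp only [if_neg this, ite_self, Finset.sum_const_zero]
  · intro θ _
    have h2 : ∀ i, (k.succAbove ∘ θ) i ≠ k := fun i => Fin.succAbove_ne k _
    simp only [if_pos h2]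
    simp only [Function.comp_apply, fiberWeight_succAbove]
    rw [← (Fin.insertNthEquiv (fun _ => X) k).sum_comp, Fintype.sum_prod_type]
    rw [Finset.sum_eq_single x]
    · refine Finset.sum_congr rfl fun h _ => ?_
      simp [Fin.insertNthEquiv, Function.comp_def]
    · intro y _ hy
      simp [Fin.insertNthEquiv, hy]
    · simp

theorem factorSum_succ {n : ℕ} (c : ℕ) (q : Fin (n + 1) → X) :
    factorSum (c + 1) q = (c + 1) * factorSum c (Fin.tail q) -
      (Finset.univ.filter (fun i => Fin.tail q i = q 0)).card * factorSum (c + 1) (Fin.tail q) := by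
  have hsplit : ∀ (k : Fin (c + 1)) (θ : Fin n → Fin (c + 1)) (h : Fin (c + 1) → X),
      (h ∘ (Fin.cons k θ : Fin (n + 1) → Fin (c + 1)) = q) ↔ (h k = q 0 ∧ h ∘ θ = Fin.tail q) := by
    intro k θ h
    simp only [funext_iff, Fin.forall_fin_succ, Function.comp_apply, Fin.cons_zero, Fin.cons_succ,
      Fin.tail]
  have hterm : ∀ (k : Fin (c + 1)) (θ : Fin n → Fin (c + 1)) (h : Fin (c + 1) → X),
      (if h ∘ (Fin.cons k θ : Fin (n + 1) → Fin (c + 1)) = q then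
        fiberWeight (Fin.cons k θ : Fin (n + 1) → Fin (c + 1)) else 0) =
      (if h k = q 0 ∧ h ∘ θ = Fin.tail q then
        (if ∀ i, θ i ≠ k then ∏ j ∈ Finset.univ.erase k,
          logWeight (Finset.univ.filter (fun i => θ i = j)).card else 0) else 0) -
      (if h k = q 0 ∧ h ∘ θ = Fin.tail q then
        (Finset.univ.filter (fun i => θ i = k)).card * fiberWeight θ else 0) := by
    intro k θ h
    by_cases hh : h k = q 0 ∧ h ∘ θ = Fin.tail q
    · rw [if_pos ((hsplit k θ h).2 hh), if_pos hh, if_pos hh, fiberWeight_cons]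
    · rw [if_neg (fun h' => hh ((hsplit k θ h).1 h')), if_neg hh, if_neg hh, sub_zero]
  have hcons : factorSum (c + 1) q =
      ∑ k : Fin (c + 1), ∑ θ : Fin n → Fin (c + 1), ∑ h : Fin (c + 1) → X,
        if h ∘ (Fin.cons k θ : Fin (n + 1) → Fin (c + 1)) = q then
          fiberWeight (Fin.cons k θ : Fin (n + 1) → Fin (c + 1)) else 0 := by
    rw [factorSum, ← (Fin.consEquiv (fun _ => Fin (c + 1))).sum_comp, Fintype.sum_prod_type]
    rfl
  rw [hcons]
  simp only [hterm, Finset.sum_sub_distrib, sum_avoiding]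
  congr 1
  · simp
  · rw [Finset.sum_comm, factorSum, Finset.mul_sum]
    refine Finset.sum_congr rfl fun θ _ => ?_
    rw [Finset.sum_comm, Finset.mul_sum]
    refine Finset.sum_congr rfl fun h _ => ?_
    by_cases hh : h ∘ θ = Fin.tail q
    · simp only [hh, and_true, if_true]
      rw [← Finset.sum_filter, ← Finset.sum_mul, ← hh]
      congr 1
      rw [Finset.card_eq_sum_card_fiberwise (f := θ) (t := Finset.univ.filter fun k => h k = q 0)
        (by intro i hi; simpa using hi)]
      push_cast
      refine Finset.sum_congr rfl fun k hk => ?_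
      congr 2
      ext i
      simp only [Finset.mem_filter, Finset.mem_univ, true_and] at hk ⊢
      constructor
      · rintro rfl; exact ⟨hk, rfl⟩
      · exact fun h => h.2
    · simp [hh]

theorem sum_factorSum {n : ℕ} (N : ℕ) (hn : n ≤ N) (q : Fin n → X) :
    ∑ c ∈ Finset.range (N + 1), (c.factorial : ℚ)⁻¹ * factorSum c q =
      if Function.Injective q then 1 else 0 := by
  induction n generalizing N with
  | zero =>
    rw [if_pos (Function.injective_of_subsingleton q), Finset.sum_range_succ']
    have h0 : factorSum 0 q = 1 := by
      simp [factorSum, fiberWeight, Subsingleton.elim _ q]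
    have hs : ∀ c, factorSum (c + 1) q = 0 := by
      intro c
      simp [factorSum, fiberWeight, logWeight]
    simp [h0, hs]
  | succ n ih =>
    obtain ⟨N, rfl⟩ : ∃ N', N = N' + 1 := ⟨N - 1, by omega⟩
    have e1 := ih N (by omega) (Fin.tail q)
    have e2 := ih (N + 1) (by omega) (Fin.tail q)
    set r : ℚ := ((Finset.univ.filter (fun i => Fin.tail q i = q 0)).card : ℚ) with hr
    have key : ∑ c ∈ Finset.range (N + 1 + 1), (c.factorial : ℚ)⁻¹ * factorSum c q =
        (1 - r) * (if Function.Injective (Fin.tail q) then 1 else 0) := by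
      rw [sub_mul, one_mul]
      nth_rw 1 [← e1]
      rw [← e2, Finset.sum_range_succ', Finset.sum_range_succ' _ (N + 1), factorSum_succ_zero]
      have hz : r * factorSum 0 (Fin.tail q) = 0 := by
        rcases n with _ | n
        · simp [hr]
        · rw [factorSum_succ_zero, mul_zero]
      rw [mul_add, mul_zero, add_zero, mul_left_comm r, hz, mul_zero, add_zero, Finset.mul_sum,
        ← Finset.sum_sub_distrib]
      refine Finset.sum_congr rfl fun c _ => ?_
      rw [factorSum_succ, ← hr, Nat.factorial_succ]
      have : (c.factorial : ℚ) ≠ 0 := by positivity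
      push_cast
      field_simp
    rw [key]
    have hq : Function.Injective q ↔ (∀ i, Fin.tail q i ≠ q 0) ∧ Function.Injective (Fin.tail q) := by
      conv_lhs => rw [← Fin.cons_self_tail q]
      rw [Fin.cons_injective_iff]
      simp
    by_cases hi : Function.Injective (Fin.tail q)
    · rw [if_pos hi, mul_one]
      by_cases h0 : ∀ i, Fin.tail q i ≠ q 0
      · rw [if_pos (hq.2 ⟨h0, hi⟩), hr]
        simp [Finset.filter_eq_empty_iff.2 (fun i _ => h0 i)]
      · rw [if_neg (fun h => h0 (hq.1 h).1)]
        push Not at h0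
        obtain ⟨i, hi0⟩ := h0
        have : Finset.univ.filter (fun i => Fin.tail q i = q 0) = {i} := by
          ext j
          simp only [Finset.mem_filter, Finset.mem_univ, true_and, Finset.mem_singleton]
          exact ⟨fun h => hi (h.trans hi0.symm), fun h => h ▸ hi0⟩
        rw [hr, this]
        simp
    · rw [if_neg hi, if_neg (fun h => hi (hq.1 h).2), mul_zero]


/-- Factorizations of `r` as a surjection followed by an injection. -/
def imageFactorEquiv {S : Type} (r : S → X) (n : ℕ) :
    {p : (S → Fin n) × (Fin n → X) //
      Function.Surjective p.1 ∧ Function.Injective p.2 ∧ p.2 ∘ p.1 = r} ≃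
      (Fin n ≃ Set.range r) where
  toFun p := Equiv.ofBijective
    (fun i => ⟨p.1.2 i, by
      obtain ⟨x, rfl⟩ := p.2.1 i
      exact ⟨x, (congrFun p.2.2.2 x).symm⟩⟩)
    ⟨fun i j h => p.2.2.1 (congrArg Subtype.val h), by
      rintro ⟨_, x, rfl⟩
      exact ⟨p.1.1 x, Subtype.ext (congrFun p.2.2.2 x)⟩⟩
  invFun e := ⟨(fun x => e.symm ⟨r x, x, rfl⟩, fun i => e i), by
      intro i
      obtain ⟨x, hx⟩ := (e i).2
      refine ⟨x, ?_⟩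
      simp [hx], Subtype.val_injective.comp e.injective, by
      ext x
      simp⟩
  left_inv p := by
    obtain ⟨⟨s, q⟩, hs, hq, rfl⟩ := p
    ext x
    · simp only
      congr 1
      rw [Equiv.symm_apply_eq]
      rfl
    · rfl
  right_inv e := by
    ext i
    rfl

theorem sum_imageFactor {S : Type} [Fintype S] [DecidableEq S] (N : ℕ) (hN : Fintype.card S ≤ N) (r : S → X) :
    ∑ n ∈ Finset.range (N + 1), (n.factorial : ℚ)⁻¹ *
      ∑ s : S → Fin n, ∑ q : Fin n → X,
        (if Function.Surjective s ∧ Function.Injective q ∧ q ∘ s = r then (1 : ℚ) else 0) = 1 := by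
  have hcount : ∀ n : ℕ, ∑ s : S → Fin n, ∑ q : Fin n → X,
      (if Function.Surjective s ∧ Function.Injective q ∧ q ∘ s = r then (1 : ℚ) else 0) =
      (Fintype.card (Fin n ≃ Set.range r) : ℚ) := by
    intro n
    rw [← Fintype.sum_prod_type' (f := fun s q =>
      (if Function.Surjective s ∧ Function.Injective q ∧ q ∘ s = r then (1 : ℚ) else 0)),
      Finset.sum_boole, ← Fintype.card_congr (imageFactorEquiv r n), Fintype.card_subtype]
  simp only [hcount]
  have hle : Fintype.card (Set.range r) ≤ N := (Fintype.card_range_le r).trans hN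
  rw [Finset.sum_eq_single (Fintype.card (Set.range r))]
  · rw [Fintype.card_equiv (Fintype.equivFin (Set.range r)).symm, Fintype.card_fin]
    have : ((Fintype.card (Set.range r)).factorial : ℚ) ≠ 0 := by positivity
    field_simp
  · intro n _ hn
    have : IsEmpty (Fin n ≃ Set.range r) :=
      ⟨fun e => hn (by simpa using Fintype.card_congr e)⟩
    simp
  · intro h
    exact absurd (Finset.mem_range.2 (by omega)) h

theorem sum_surjective_factor {R : Type} [CommRing R] [Algebra ℚ R] {S : Type} [Fintype S] [DecidableEq S]
    (N : ℕ) (hN : Fintype.card S ≤ N) (Y : ∀ n : ℕ, (S → Fin n) → (Fin n → X) → R)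
    (Z : (S → X) → R)
    (hY : ∀ (n : ℕ) (s : S → Fin n) (q : Fin n → X), Function.Injective q → Y n s q = Z (q ∘ s)) :
    ∑ c ∈ Finset.range (N + 1), ∑ n ∈ Finset.range (N + 1),
      ((c.factorial : ℚ)⁻¹ * (n.factorial : ℚ)⁻¹) • ∑ s : S → Fin n,
        ∑ θ : Fin n → Fin c, ∑ h : Fin c → X,
          (if Function.Surjective s then fiberWeight θ • Y n s (h ∘ θ) else 0) = ∑ r, Z r := by
  have h1 : ∀ (n c : ℕ) (s : S → Fin n), ∑ θ : Fin n → Fin c, ∑ h : Fin c → X,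
      (if Function.Surjective s then fiberWeight θ • Y n s (h ∘ θ) else 0) =
      ∑ q : Fin n → X, factorSum c q • (if Function.Surjective s then Y n s q else 0) := by
    intro n c s
    by_cases hs : Function.Surjective s
    · simp only [if_pos hs, factorSum, Finset.sum_smul]
      conv_rhs => rw [Finset.sum_comm]
      refine Finset.sum_congr rfl fun θ _ => ?_
      conv_rhs => rw [Finset.sum_comm]
      refine Finset.sum_congr rfl fun h _ => ?_
      simp [ite_smul]
    · simp [hs]
  have h2 : ∀ n ∈ Finset.range (N + 1), ∑ c ∈ Finset.range (N + 1),
      ((c.factorial : ℚ)⁻¹ * (n.factorial : ℚ)⁻¹) • ∑ s : S → Fin n,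
        ∑ q : Fin n → X, factorSum c q • (if Function.Surjective s then Y n s q else 0) =
      ∑ r : S → X, ((n.factorial : ℚ)⁻¹ * ∑ s : S → Fin n, ∑ q : Fin n → X,
        (if Function.Surjective s ∧ Function.Injective q ∧ q ∘ s = r then (1 : ℚ) else 0)) • Z r := by
    intro n hn
    have hn' : n ≤ N := by simpa [Nat.lt_succ_iff] using hn
    simp only [mul_smul, Finset.sum_smul, ← Finset.smul_sum]
    simp only [smul_comm _ ((n.factorial : ℚ)⁻¹)]
    rw [← Finset.smul_sum]
    congr 1
    simp only [Finset.smul_sum]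
    rw [Finset.sum_comm]
    conv_rhs => rw [Finset.sum_comm]
    refine Finset.sum_congr rfl fun s _ => ?_
    rw [Finset.sum_comm]
    conv_rhs => rw [Finset.sum_comm]
    refine Finset.sum_congr rfl fun q _ => ?_
    simp only [smul_smul, ← Finset.sum_smul]
    rw [sum_factorSum N hn' q]
    by_cases hs : Function.Surjective s <;> by_cases hq : Function.Injective q
    · simp [hs, hq, hY n s q hq]
    all_goals simp [hs, hq]
  rw [Finset.sum_comm]
  simp only [h1]
  rw [Finset.sum_congr rfl h2, Finset.sum_comm]
  refine Finset.sum_congr rfl fun r _ => ?_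
  rw [← Finset.sum_smul, sum_imageFactor N hN r, one_smul]

end Factorizations

theorem fiberWeight_eq {n c : ℕ} (θ : Fin n → Fin c) :
    fiberWeight θ = if Function.Surjective θ then (-1) ^ (n + c) *
      ∏ k : Fin c, (((Finset.univ.filter (fun x : Fin n => θ x = k)).card - 1).factorial : ℚ)
      else 0 := by
  split_ifs with hθ
  · have hpos : ∀ k, (Finset.univ.filter (fun i => θ i = k)).card ≠ 0 := by
      intro k
      obtain ⟨i, hi⟩ := hθ k
      exact Finset.card_ne_zero_of_mem (a := i) (by simp [hi])
    simp only [fiberWeight, logWeight, if_neg (hpos _), Finset.prod_mul_distrib]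
    rw [Finset.prod_pow_eq_pow_sum, Finset.sum_add_distrib]
    congr 2
    have := Finset.card_eq_sum_card_fiberwise (s := Finset.univ) (t := Finset.univ) (f := θ)
      (by intro i hi; simp)
    simp only [Finset.card_univ, Fintype.card_fin] at this
    simp [← this]
  · simp only [Function.Surjective, not_forall, not_exists] at hθ
    obtain ⟨k, hk⟩ := hθ
    refine Finset.prod_eq_zero (Finset.mem_univ k) ?_
    simp [hk, logWeight]

theorem exists_perm_of_map_eq {β : Type} {c : ℕ} {f g : Fin c → β}
    (h : Multiset.map f Finset.univ.val = Multiset.map g Finset.univ.val) :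
    ∃ σ : Equiv.Perm (Fin c), f ∘ σ = g := by
  have hc : ∀ y, Nonempty ({i // f i = y} ≃ {i // g i = y}) := by
    intro y
    have := congrArg (Multiset.count y) h
    rw [Multiset.count_map, Multiset.count_map] at this
    refine Fintype.card_eq.1 ?_
    rw [Fintype.card_subtype, Fintype.card_subtype]
    simpa [Finset.card_def, Finset.filter_val, eq_comm] using this
  let e := fun y => (hc y).some
  refine ⟨((Equiv.sigmaFiberEquiv g).symm.trans
    (Equiv.sigmaCongrRight fun y => (e y).symm)).trans (Equiv.sigmaFiberEquiv f), ?_⟩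
  ext i
  exact ((e (g i)).symm ⟨i, rfl⟩).2

theorem map_comp_perm {β : Type} {c : ℕ} (f : Fin c → β) (σ : Equiv.Perm (Fin c)) :
    Multiset.map (f ∘ σ) Finset.univ.val = Multiset.map f Finset.univ.val := by
  rw [← Multiset.map_map, Multiset.map_univ_val_equiv]

theorem card_perm_comp_eq {β : Type} {c : ℕ} (f g : Fin c → β) :
    Nat.card {σ : Equiv.Perm (Fin c) // f ∘ σ = g} =
      if Multiset.map f Finset.univ.val = Multiset.map g Finset.univ.val then
        Nat.card {σ : Equiv.Perm (Fin c) // g ∘ σ = g} else 0 := by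
  split_ifs with h
  · obtain ⟨τ, rfl⟩ := exists_perm_of_map_eq h
    refine Nat.card_congr ((Equiv.mulLeft τ⁻¹).subtypeEquiv fun σ => ?_)
    simp [Function.comp_def]
  · have : IsEmpty {σ : Equiv.Perm (Fin c) // f ∘ σ = g} :=
      ⟨fun σ => h (by rw [← σ.2, map_comp_perm])⟩
    simp

theorem sum_orbit {R : Type} [CommRing R] [Algebra ℚ R] {β T : Type} [Fintype T] {c : ℕ}
    (A : T → Fin c → β) (Z : T → R)
    (act : Equiv.Perm (Fin c) → Equiv.Perm T) (hA : ∀ σ t, A (act σ t) = A t ∘ σ)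
    (hZ : ∀ σ t, Z (act σ t) = Z t) (g : Fin c → β) :
    (Nat.card {σ : Equiv.Perm (Fin c) // g ∘ σ = g} : ℚ)⁻¹ • (∑ t, if A t = g then Z t else 0) =
      (c.factorial : ℚ)⁻¹ • ∑ t,
        if Multiset.map (A t) Finset.univ.val = Multiset.map g Finset.univ.val then Z t else 0 := by
  have h1 : ∀ σ : Equiv.Perm (Fin c), (∑ t, if A t = g then Z t else 0) =
      ∑ t, if A t ∘ σ = g then Z t else 0 := by
    intro σ
    rw [← Equiv.sum_comp (act σ)]
    simp only [hA, hZ]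
  have h2 : (c.factorial : ℚ) • (∑ t, if A t = g then Z t else 0) =
      (Nat.card {σ : Equiv.Perm (Fin c) // g ∘ σ = g} : ℚ) • ∑ t,
        if Multiset.map (A t) Finset.univ.val = Multiset.map g Finset.univ.val then Z t else 0 := by
    have : (c.factorial : ℚ) • (∑ t, if A t = g then Z t else 0) =
        ∑ σ : Equiv.Perm (Fin c), ∑ t, if A t = g then Z t else 0 := by
      rw [Finset.sum_const, Finset.card_univ, Fintype.card_perm, Fintype.card_fin]
      simp [Algebra.smul_def]
    rw [this, Finset.sum_congr rfl fun σ _ => h1 σ, Finset.sum_comm, Finset.smul_sum]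
    refine Finset.sum_congr rfl fun t _ => ?_
    rw [← Finset.sum_filter, Finset.sum_const, ← Fintype.card_subtype, ← Nat.card_eq_fintype_card,
      card_perm_comp_eq]
    split_ifs <;> simp [Algebra.smul_def]
  have hc : (c.factorial : ℚ) ≠ 0 := by positivity
  have : Nonempty {σ : Equiv.Perm (Fin c) // g ∘ σ = g} := ⟨⟨1, rfl⟩⟩
  have hn : (Nat.card {σ : Equiv.Perm (Fin c) // g ∘ σ = g} : ℚ) ≠ 0 :=
    Nat.cast_ne_zero.2 Nat.card_pos.ne'
  rw [inv_smul_eq_iff₀ hn, smul_comm, eq_inv_smul_iff₀ hc, h2]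

/-- The total of `κ` over each fibre of `f`. -/
def pushSum {ι Y : Type} [Fintype ι] [DecidableEq Y] (κ : ι → G) (f : ι → Y) (y : Y) : G :=
  ∑ i ∈ Finset.univ.filter (fun i => f i = y), κ i

theorem pushSum_eq_sum_ite {ι Y : Type} [Fintype ι] [DecidableEq Y] (κ : ι → G) (f : ι → Y)
    (y : Y) : pushSum κ f y = ∑ i, if f i = y then κ i else 0 :=
  Finset.sum_filter _ _

theorem pushSum_pushSum {ι Y W : Type} [Fintype ι] [Fintype Y] [DecidableEq Y] [DecidableEq W]
    (κ : ι → G) (f : ι → Y) (h : Y → W) : pushSum (pushSum κ f) h = pushSum κ (h ∘ f) := by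
  ext w
  simp only [pushSum_eq_sum_ite, Function.comp_apply]
  rw [← Finset.sum_filter, Finset.sum_comm]
  refine Finset.sum_congr rfl fun i _ => ?_
  simp

theorem pushSum_add {ι Y : Type} [Fintype ι] [DecidableEq Y] (κ lam : ι → G) (f : ι → Y) :
    pushSum (κ + lam) f = pushSum κ f + pushSum lam f := by
  ext y
  simp [pushSum, Finset.sum_add_distrib]

theorem pushSum_comp_perm {ι Y : Type} [Fintype ι] [DecidableEq Y] (κ : ι → G) (f : ι → Y)
    (σ : Equiv.Perm ι) : pushSum (κ ∘ σ) (f ∘ σ) = pushSum κ f := by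
  ext y
  simp only [pushSum_eq_sum_ite, Function.comp_apply]
  exact Equiv.sum_comp σ (fun i => if f i = y then κ i else 0)

theorem pushSum_perm_inv {ι Y : Type} [Fintype ι] [DecidableEq Y] (κ : ι → G) (f : ι → Y)
    (σ : Equiv.Perm Y) : pushSum κ (⇑σ⁻¹ ∘ f) = pushSum κ f ∘ σ := by
  ext y
  simp only [pushSum_eq_sum_ite, Function.comp_apply, Equiv.Perm.inv_eq_iff_eq]

/-- The cocycle twisting the addition of functions `Fin N → G`. -/
def twist (χ : G →+ G →+ ℤ) (l : Λˣ) {N : ℕ} (α β : Fin N → G) : Λˣ :=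
  l ^ (-∑ x, χ (α x) (β x))

theorem twist_add_left (χ : G →+ G →+ ℤ) (l : Λˣ) {N : ℕ} (α α' β : Fin N → G) :
    twist χ l (α + α') β = twist χ l α β * twist χ l α' β := by
  simp only [twist, ← zpow_add, Pi.add_apply, map_add, AddMonoidHom.add_apply,
    Finset.sum_add_distrib, neg_add]

theorem twist_add_right (χ : G →+ G →+ ℤ) (l : Λˣ) {N : ℕ} (α β β' : Fin N → G) :
    twist χ l α (β + β') = twist χ l α β * twist χ l α β' := by
  simp only [twist, ← zpow_add, Pi.add_apply, map_add, Finset.sum_add_distrib, neg_add]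

theorem prod_zpow_eq_zpow_sum {ι : Type} (l : Λˣ) (s : Finset ι) (e : ι → ℤ) :
    ∏ i ∈ s, l ^ e i = l ^ ∑ i ∈ s, e i := by
  induction s using Finset.cons_induction with
  | empty => simp
  | cons a s ha ih => rw [Finset.prod_cons, Finset.sum_cons, ih, zpow_add]

/-- The product of the factors `ℓ ^ (-χ(λ(j), κ(i)))` over the pairs with `φ i = ψ j`. -/
def pairWeight (χ : G → G → ℤ) (l : Λˣ) {a b : ℕ} {Y : Type} [DecidableEq Y]
    (κ : Fin a → G) (lam : Fin b → G) (φ : Fin a → Y) (ψ : Fin b → Y) : Λ :=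
  ∏ q ∈ Finset.univ.filter (fun q : Fin a × Fin b => φ q.1 = ψ q.2),
    ((l ^ (-χ (lam q.2) (κ q.1)) : Λˣ) : Λ)

theorem pairWeight_comp (χ : G → G → ℤ) (l : Λˣ) {a b : ℕ} {Y W : Type} [DecidableEq Y]
    [DecidableEq W] (κ : Fin a → G) (lam : Fin b → G) (φ : Fin a → Y) (ψ : Fin b → Y)
    {q : Y → W} (hq : Function.Injective q) :
    pairWeight χ l κ lam (q ∘ φ) (q ∘ ψ) = pairWeight χ l κ lam φ ψ := by
  simp only [pairWeight, Function.comp_apply, hq.eq_iff]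

theorem twist_pushSum (χ : G →+ G →+ ℤ) (l : Λˣ) {a b N : ℕ}
    (κ : Fin a → G) (lam : Fin b → G) (f : Fin a → Fin N) (g : Fin b → Fin N) :
    (twist χ l (pushSum lam g) (pushSum κ f) : Λ) =
      pairWeight (fun x y => χ x y) l κ lam f g := by
  rw [pairWeight, ← Units.coe_prod, prod_zpow_eq_zpow_sum, twist, Finset.sum_neg_distrib]
  congr 3
  simp only [pushSum_eq_sum_ite, map_sum, AddMonoidHom.finsetSum_apply, Finset.sum_filter,
    Fintype.sum_prod_type]
  rw [Finset.sum_comm]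
  refine Finset.sum_congr rfl fun i _ => ?_
  rw [Finset.sum_comm]
  refine Finset.sum_congr rfl fun j _ => ?_
  rw [Finset.sum_eq_single (f i)]
  · by_cases h : f i = g j
    · simp [h]
    · simp [h, Ne.symm h]
  · intro x _ hx
    simp [hx.symm]
  · simp

/-- The operator on functions given by translation by `α` twisted by the cocycle. -/
def shiftOp (χ : G →+ G →+ ℤ) (l : Λˣ) {N : ℕ} (α : Fin N → G) :
    Module.End Λ ((Fin N → G) → Λ) where
  toFun F γ := (twist χ l α γ : Λ) * F (α + γ)
  map_add' F F' := by ext γ; simp [mul_add]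
  map_smul' r F := by ext γ; simp [mul_left_comm]

theorem shiftOp_apply (χ : G →+ G →+ ℤ) (l : Λˣ) {N : ℕ} (α : Fin N → G)
    (F : (Fin N → G) → Λ) (γ : Fin N → G) :
    shiftOp χ l α F γ = (twist χ l α γ : Λ) * F (α + γ) := rfl

theorem shiftOp_mul (χ : G →+ G →+ ℤ) (l : Λˣ) {N : ℕ} (α β : Fin N → G) :
    shiftOp χ l α * shiftOp χ l β = (twist χ l β α : Λ) • shiftOp χ l (α + β) := by
  ext F γ
  simp only [Module.End.mul_apply, LinearMap.smul_apply, Pi.smul_apply, smul_eq_mul,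
    shiftOp_apply, twist_add_left, twist_add_right, Units.val_mul]
  rw [add_left_comm, ← add_assoc]
  ring

theorem shiftOp_zero (χ : G →+ G →+ ℤ) (l : Λˣ) {N : ℕ} :
    shiftOp χ l (0 : Fin N → G) = 1 := by
  ext F γ
  simp [shiftOp_apply, twist]

theorem map_repF {Cbar : AddSubmonoid G} (m : Multiset (Cpos Cbar)) :
    Multiset.map (repF m) Finset.univ.val = m := by
  have : List.ofFn (repF m) = m.toList := by
    apply List.ext_get
    · simp
    · intro i h1 h2
      simp [repF]
  conv_rhs => rw [← Multiset.coe_toList m, ← this]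
  rw [Fin.univ_val_map]

/-- The function `μ` determined by the maps `φ`, `ψ`, `θ`. -/
def targetSum {Cbar : AddSubmonoid G} {a b c n : ℕ}
    (κ : Fin a → Cpos Cbar) (lam : Fin b → Cpos Cbar)
    (t : (Fin a → Fin n) × (Fin b → Fin n) × (Fin n → Fin c)) : Fin c → G :=
  pushSum (fun i => (κ i : G)) (t.2.2 ∘ t.1) + pushSum (fun j => (lam j : G)) (t.2.2 ∘ t.2.1)

/-- The contribution of `(φ, ψ, θ)` to the value of a product on the function `P`. -/
def tripleTerm {Cbar : AddSubmonoid G} (χ : G → G → ℤ) (l : Λˣ) {a b c n N : ℕ}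
    (κ : Fin a → Cpos Cbar) (lam : Fin b → Cpos Cbar) (P : (Fin N → G) → Λ)
    (t : (Fin a → Fin n) × (Fin b → Fin n) × (Fin n → Fin c)) : Λ :=
  if Function.Surjective (Sum.elim t.1 t.2.1) ∧ Function.Surjective t.2.2 then
    (∏ k : Fin c,
      (((Finset.univ.filter (fun x : Fin n => t.2.2 x = k)).card - 1).factorial : ℚ)) •
      (pairWeight χ l (fun i => (κ i : G)) (fun j => (lam j : G)) t.1 t.2.1 *
        ∑ h : Fin c → Fin N, P (pushSum (targetSum κ lam t) h))
  else 0

/-- The action of a permutation of `K` on triples `(φ, ψ, θ)`. -/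
def actTriple {a b c n : ℕ} (σ : Equiv.Perm (Fin c)) :
    Equiv.Perm ((Fin a → Fin n) × (Fin b → Fin n) × (Fin n → Fin c)) :=
  (Equiv.refl _).prodCongr ((Equiv.refl _).prodCongr (Equiv.arrowCongr (Equiv.refl _) σ⁻¹))

theorem actTriple_apply {a b c n : ℕ} (σ : Equiv.Perm (Fin c))
    (t : (Fin a → Fin n) × (Fin b → Fin n) × (Fin n → Fin c)) :
    actTriple σ t = (t.1, t.2.1, ⇑σ⁻¹ ∘ t.2.2) := rfl

theorem targetSum_actTriple {Cbar : AddSubmonoid G} {a b c n : ℕ}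
    (κ : Fin a → Cpos Cbar) (lam : Fin b → Cpos Cbar) (σ : Equiv.Perm (Fin c))
    (t : (Fin a → Fin n) × (Fin b → Fin n) × (Fin n → Fin c)) :
    targetSum κ lam (actTriple σ t) = targetSum κ lam t ∘ σ := by
  simp only [targetSum, actTriple_apply, Function.comp_assoc, pushSum_perm_inv]
  rfl

theorem tripleTerm_actTriple {Cbar : AddSubmonoid G} (χ : G → G → ℤ) (l : Λˣ) {a b c n N : ℕ}
    (κ : Fin a → Cpos Cbar) (lam : Fin b → Cpos Cbar) (P : (Fin N → G) → Λ)
    (σ : Equiv.Perm (Fin c)) (t : (Fin a → Fin n) × (Fin b → Fin n) × (Fin n → Fin c)) :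
    tripleTerm χ l κ lam P (actTriple σ t) = tripleTerm χ l κ lam P t := by
  have h1 : Function.Surjective (⇑σ⁻¹ ∘ t.2.2) ↔ Function.Surjective t.2.2 :=
    Equiv.comp_surjective _ _
  have h2 : ∏ k : Fin c, (((Finset.univ.filter
      (fun x : Fin n => (⇑σ⁻¹ ∘ t.2.2) x = k)).card - 1).factorial : ℚ) =
      ∏ k : Fin c, (((Finset.univ.filter (fun x : Fin n => t.2.2 x = k)).card - 1).factorial : ℚ) := by
    simp only [Function.comp_apply, Equiv.Perm.inv_eq_iff_eq]
    exact Equiv.prod_comp σ (fun k =>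
      (((Finset.univ.filter (fun x : Fin n => t.2.2 x = k)).card - 1).factorial : ℚ))
  have h3 : ∑ h : Fin c → Fin N, P (pushSum (targetSum κ lam t ∘ σ) h) =
      ∑ h : Fin c → Fin N, P (pushSum (targetSum κ lam t) h) := by
    rw [← Equiv.sum_comp (σ⁻¹.arrowCongr (Equiv.refl (Fin N)))]
    refine Finset.sum_congr rfl fun h _ => ?_
    exact congrArg P (pushSum_comp_perm _ h σ)
  simp only [tripleTerm, targetSum_actTriple, h3]
  simp only [actTriple_apply, h1]
  split_ifs
  · exact congrArg (· • _) h2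
  · rfl

theorem coeff614_mul {Cbar : AddSubmonoid G} (χ : G → G → ℤ) (l u : Λˣ) {a b c N : ℕ}
    (κ : Fin a → Cpos Cbar) (lam : Fin b → Cpos Cbar) (μ : Fin c → Cpos Cbar)
    (P : (Fin N → G) → Λ) :
    coeff614 χ l u κ lam μ *
      (((u ^ (-(c : ℤ)) : Λˣ) : Λ) * ∑ h : Fin c → Fin N, P (pushSum (fun k => (μ k : G)) h)) =
    ((u ^ (-(a : ℤ) - (b : ℤ)) : Λˣ) : Λ) * ∑ n ∈ Finset.range (a + b + 1),
      ((-1 : ℚ) ^ (n + c) * (n.factorial : ℚ)⁻¹ * (c.factorial : ℚ)⁻¹) •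
        ∑ t : (Fin a → Fin n) × (Fin b → Fin n) × (Fin n → Fin c),
          if Multiset.map (targetSum κ lam t) Finset.univ.val =
            (Multiset.map μ Finset.univ.val).map Subtype.val
          then tripleTerm χ l κ lam P t else 0 := by
  have hu : ((u ^ ((c : ℤ) - (a : ℤ) - (b : ℤ)) : Λˣ) : Λ) * ((u ^ (-(c : ℤ)) : Λˣ) : Λ) =
      ((u ^ (-(a : ℤ) - (b : ℤ)) : Λˣ) : Λ) := by
    rw [← Units.val_mul, ← zpow_add]
    congr 2
    ring
  have haut : autCard μ =
      Nat.card {σ : Equiv.Perm (Fin c) // (fun k => (μ k : G)) ∘ σ = fun k => (μ k : G)} := by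
    refine Nat.card_congr (Equiv.subtypeEquivRight fun σ => ?_)
    simp only [funext_iff, Function.comp_apply, Subtype.ext_iff]
  have horb : ∀ n : ℕ, (autCard μ : ℚ)⁻¹ •
        (∑ t : (Fin a → Fin n) × (Fin b → Fin n) × (Fin n → Fin c),
          if targetSum κ lam t = (fun k => (μ k : G)) then tripleTerm χ l κ lam P t else 0) =
      (c.factorial : ℚ)⁻¹ • ∑ t : (Fin a → Fin n) × (Fin b → Fin n) × (Fin n → Fin c),
          if Multiset.map (targetSum κ lam t) Finset.univ.val =
            (Multiset.map μ Finset.univ.val).map Subtype.val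
          then tripleTerm χ l κ lam P t else 0 := by
    intro n
    rw [haut, sum_orbit (targetSum κ lam) (tripleTerm χ l κ lam P) actTriple
      (targetSum_actTriple κ lam) (tripleTerm_actTriple χ l κ lam P), Multiset.map_map]
    rfl
  simp only [mul_smul, ← horb]
  rw [← hu, coeff614]
  set H := ∑ h : Fin c → Fin N, P (pushSum (fun k => (μ k : G)) h) with hH
  have hrearrange : ∀ x y z w : Λ, x * y * z * (w * H) = x * w * (y * (z * H)) := by
    intros; ring
  rw [hrearrange, Finset.sum_mul, Finset.mul_sum]
  congr 1
  refine Finset.sum_congr rfl fun n _ => ?_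
  rw [mul_assoc (algebraMap ℚ Λ _)]
  trans algebraMap ℚ Λ (autCard μ : ℚ)⁻¹ *
    (algebraMap ℚ Λ ((-1 : ℚ) ^ (n + c) / (n.factorial : ℚ)) *
      ∑ t : (Fin a → Fin n) × (Fin b → Fin n) × (Fin n → Fin c),
        if targetSum κ lam t = (fun k => (μ k : G)) then tripleTerm χ l κ lam P t else 0)
  · congr 2
    rw [Finset.sum_mul, Finset.sum_filter]
    refine Finset.sum_congr rfl fun t _ => ?_
    have hiff : (∀ k : Fin c, (μ k : G) =
        (∑ i ∈ Finset.univ.filter (fun i : Fin a => t.2.2 (t.1 i) = k), ((κ i : G))) +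
          ∑ j ∈ Finset.univ.filter (fun j : Fin b => t.2.2 (t.2.1 j) = k), ((lam j : G))) ↔
        targetSum κ lam t = (fun k => (μ k : G)) := by
      rw [funext_iff]
      exact forall_congr' fun k => eq_comm
    by_cases ht : targetSum κ lam t = (fun k => (μ k : G))
    · rw [if_pos ht, tripleTerm, ht, ← hH, Algebra.smul_def, ← mul_assoc]
      by_cases hs : Function.Surjective (Sum.elim t.1 t.2.1) ∧ Function.Surjective t.2.2
      · rw [if_pos hs, if_pos ⟨hs.1, hs.2, hiff.2 ht⟩]
        rfl
      · rw [if_neg hs, if_neg (fun h => hs ⟨h.1, h.2.1⟩)]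
    · rw [if_neg ht, if_neg (fun h => ht (hiff.1 h.2.2))]
  · simp only [Algebra.smul_def, div_eq_mul_inv, map_mul]
    ring

theorem map_targetμ {Cbar : AddSubmonoid G}
    (hC : ∀ x ∈ Cbar, ∀ y ∈ Cbar, x + y = 0 → x = 0 ∧ y = 0) {a b c n : ℕ}
    (κ : Fin a → Cpos Cbar) (lam : Fin b → Cpos Cbar)
    (t : (Fin a → Fin n) × (Fin b → Fin n) × (Fin n → Fin c))
    (hρ : Function.Surjective (t.2.2 ∘ Sum.elim t.1 t.2.1)) :
    (Multiset.map (targetμ hC κ lam hρ) Finset.univ.val).map Subtype.val =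
      Multiset.map (targetSum κ lam t) Finset.univ.val := by
  rw [Multiset.map_map]
  refine Multiset.map_congr rfl fun k _ => ?_
  simp only [Function.comp_apply, targetμ, Finset.sum_filter, Fintype.sum_sum_type, Sum.elim_inl,
    Sum.elim_inr, targetSum, Pi.add_apply, pushSum_eq_sum_ite]
  rfl

theorem sum_candidates {Cbar : AddSubmonoid G}
    (hC : ∀ x ∈ Cbar, ∀ y ∈ Cbar, x + y = 0 → x = 0 ∧ y = 0)
    (χ : G → G → ℤ) (l : Λˣ) {a b c n N : ℕ} (hc : c ∈ Finset.range (a + b + 1))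
    (κ : Fin a → Cpos Cbar) (lam : Fin b → Cpos Cbar) (P : (Fin N → G) → Λ) :
    ∑ m ∈ (candidatesB hC κ lam).filter (fun m => Multiset.card m = c),
      ∑ t : (Fin a → Fin n) × (Fin b → Fin n) × (Fin n → Fin c),
        (if Multiset.map (targetSum κ lam t) Finset.univ.val = m.map Subtype.val
          then tripleTerm χ l κ lam P t else 0) =
    ∑ t : (Fin a → Fin n) × (Fin b → Fin n) × (Fin n → Fin c), tripleTerm χ l κ lam P t := by
  rw [Finset.sum_comm]
  refine Finset.sum_congr rfl fun t _ => ?_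
  by_cases hs : Function.Surjective (Sum.elim t.1 t.2.1) ∧ Function.Surjective t.2.2
  · have hρ : Function.Surjective (t.2.2 ∘ Sum.elim t.1 t.2.1) := hs.2.comp hs.1
    rw [Finset.sum_eq_single (Multiset.map (targetμ hC κ lam hρ) Finset.univ.val)]
    · rw [map_targetμ, if_pos rfl]
    · intro m _ hm
      rw [← map_targetμ hC κ lam t hρ, if_neg]
      exact fun h => hm (Multiset.map_injective Subtype.val_injective h).symm
    · intro h
      refine absurd (Finset.mem_filter.2 ⟨?_, by simp⟩) h
      exact Finset.mem_biUnion.2 ⟨c, hc, Finset.mem_image.2 ⟨⟨_, hρ⟩, Finset.mem_univ _, rfl⟩⟩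
  · simp [tripleTerm, hs]

theorem card_mem_candidates {Cbar : AddSubmonoid G}
    (hC : ∀ x ∈ Cbar, ∀ y ∈ Cbar, x + y = 0 → x = 0 ∧ y = 0) {a b : ℕ}
    (κ : Fin a → Cpos Cbar) (lam : Fin b → Cpos Cbar) {m : Multiset (Cpos Cbar)}
    (hm : m ∈ candidatesB hC κ lam) : Multiset.card m ∈ Finset.range (a + b + 1) := by
  obtain ⟨c, hc, h⟩ := Finset.mem_biUnion.1 hm
  obtain ⟨ρ, -, rfl⟩ := Finset.mem_image.1 h
  simpa using hc

theorem smul_tripleTerm {Cbar : AddSubmonoid G} (χ : G → G → ℤ) (l : Λˣ) {a b c n N : ℕ}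
    (κ : Fin a → Cpos Cbar) (lam : Fin b → Cpos Cbar) (P : (Fin N → G) → Λ)
    (t : (Fin a → Fin n) × (Fin b → Fin n) × (Fin n → Fin c)) :
    ((-1 : ℚ) ^ (n + c)) • tripleTerm χ l κ lam P t =
      ∑ h : Fin c → Fin N, if Function.Surjective (Sum.elim t.1 t.2.1) then
        fiberWeight t.2.2 • (pairWeight χ l (fun i => (κ i : G)) (fun j => (lam j : G)) t.1 t.2.1 *
          P (pushSum (fun i => (κ i : G)) ((h ∘ t.2.2) ∘ t.1) +
            pushSum (fun j => (lam j : G)) ((h ∘ t.2.2) ∘ t.2.1))) else 0 := by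
  rw [tripleTerm, fiberWeight_eq]
  by_cases h1 : Function.Surjective (Sum.elim t.1 t.2.1)
  · by_cases h2 : Function.Surjective t.2.2
    · simp only [h1, h2, and_self, if_true, targetSum, pushSum_add, pushSum_pushSum, smul_smul,
        Function.comp_assoc, ← Finset.smul_sum, ← Finset.mul_sum]
    · simp [h2]
  · simp [h1]

theorem sum_arrow_sum {α β Y R : Type} [AddCommMonoid R] [Fintype (α ⊕ β → Y)]
    [Fintype (α → Y)] [Fintype (β → Y)] (F : (α ⊕ β → Y) → R) :
    ∑ r, F r = ∑ f : α → Y, ∑ g : β → Y, F (Sum.elim f g) := by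
  rw [← Equiv.sum_comp (Equiv.sumArrowEquivProdArrow α β Y).symm, Fintype.sum_prod_type]
  rfl

theorem sum_product_eval {Cbar : AddSubmonoid G}
    (hC : ∀ x ∈ Cbar, ∀ y ∈ Cbar, x + y = 0 → x = 0 ∧ y = 0)
    (χ : G → G → ℤ) (l u : Λˣ) {a b N : ℕ}
    (κ : Fin a → Cpos Cbar) (lam : Fin b → Cpos Cbar) (P : (Fin N → G) → Λ) :
    ∑ m ∈ candidatesB hC κ lam, coeff614 χ l u κ lam (repF m) *
      (((u ^ (-(Multiset.card m : ℤ)) : Λˣ) : Λ) *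
        ∑ h : Fin (Multiset.card m) → Fin N, P (pushSum (fun k => (repF m k : G)) h)) =
    ((u ^ (-(a : ℤ) - (b : ℤ)) : Λˣ) : Λ) * ∑ f : Fin a → Fin N, ∑ g : Fin b → Fin N,
      pairWeight χ l (fun i => (κ i : G)) (fun j => (lam j : G)) f g *
        P (pushSum (fun i => (κ i : G)) f + pushSum (fun j => (lam j : G)) g) := by
  simp only [coeff614_mul, map_repF]
  rw [← Finset.mul_sum]
  congr 1
  rw [← Finset.sum_fiberwise_of_maps_to (g := fun m : Multiset (Cpos Cbar) => Multiset.card m)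
    (fun m hm => card_mem_candidates hC κ lam hm)]
  have hS := sum_surjective_factor (R := Λ) (X := Fin N) (S := Fin a ⊕ Fin b) (a + b) (by simp)
    (fun n s q =>
      pairWeight χ l (fun i => (κ i : G)) (fun j => (lam j : G)) (s ∘ Sum.inl) (s ∘ Sum.inr) *
        P (pushSum (fun i => (κ i : G)) (q ∘ s ∘ Sum.inl) +
          pushSum (fun j => (lam j : G)) (q ∘ s ∘ Sum.inr)))
    (fun r =>
      pairWeight χ l (fun i => (κ i : G)) (fun j => (lam j : G)) (r ∘ Sum.inl) (r ∘ Sum.inr) *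
        P (pushSum (fun i => (κ i : G)) (r ∘ Sum.inl) +
          pushSum (fun j => (lam j : G)) (r ∘ Sum.inr)))
    (fun n s q hq => by
      simp only [Function.comp_assoc, pairWeight_comp χ l _ _ _ _ hq])
  rw [sum_arrow_sum] at hS
  refine Eq.trans ?_ hS
  refine Finset.sum_congr rfl fun c hc => ?_
  trans ∑ m ∈ (candidatesB hC κ lam).filter (fun m => Multiset.card m = c),
    ∑ n ∈ Finset.range (a + b + 1),
      ((-1 : ℚ) ^ (n + c) * (n.factorial : ℚ)⁻¹ * (c.factorial : ℚ)⁻¹) •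
        ∑ t : (Fin a → Fin n) × (Fin b → Fin n) × (Fin n → Fin c),
          if Multiset.map (targetSum κ lam t) Finset.univ.val = m.map Subtype.val
          then tripleTerm χ l κ lam P t else 0
  · refine Finset.sum_congr rfl fun m hm => ?_
    obtain ⟨_, rfl⟩ := Finset.mem_filter.1 hm
    rfl
  rw [Finset.sum_comm]
  refine Finset.sum_congr rfl fun n _ => ?_
  rw [← Finset.smul_sum, sum_candidates hC χ l hc κ lam P, mul_assoc, mul_comm, mul_smul,
    mul_comm (n.factorial : ℚ)⁻¹, Finset.smul_sum]
  congr 1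
  simp only [smul_tripleTerm]
  rw [Fintype.sum_prod_type, sum_arrow_sum]
  refine Finset.sum_congr rfl fun φ _ => ?_
  rw [Fintype.sum_prod_type]
  rfl

/-- The action of `B(𝒜,Λ,χ)` on functions of `Fin N → G`. -/
def fock {Cbar : AddSubmonoid G} (χ : G →+ G →+ ℤ) (l u : Λˣ) (N : ℕ) :
    (Multiset (Cpos Cbar) →₀ Λ) →ₗ[Λ] Module.End Λ ((Fin N → G) → Λ) :=
  Finsupp.linearCombination Λ fun m => ((u ^ (-(Multiset.card m : ℤ)) : Λˣ) : Λ) •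
    ∑ h : Fin (Multiset.card m) → Fin N, shiftOp χ l (pushSum (fun k => (repF m k : G)) h)

theorem fock_single {Cbar : AddSubmonoid G} (χ : G →+ G →+ ℤ) (l u : Λˣ) (N : ℕ)
    (m : Multiset (Cpos Cbar)) (x : Λ) :
    fock χ l u N (Finsupp.single m x) = x • ((u ^ (-(Multiset.card m : ℤ)) : Λˣ) : Λ) •
      ∑ h : Fin (Multiset.card m) → Fin N, shiftOp χ l (pushSum (fun k => (repF m k : G)) h) := by
  rw [fock, Finsupp.linearCombination_single]

theorem fock_single_mul {Cbar : AddSubmonoid G}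
    (hC : ∀ x ∈ Cbar, ∀ y ∈ Cbar, x + y = 0 → x = 0 ∧ y = 0)
    (χ : G →+ G →+ ℤ) (l u : Λˣ) (N : ℕ) (m₁ m₂ : Multiset (Cpos Cbar)) :
    ∑ m ∈ candidatesB hC (repF m₁) (repF m₂),
      coeff614 (fun x y => χ x y) l u (repF m₁) (repF m₂) (repF m) •
        fock χ l u N (Finsupp.single m 1) =
    fock χ l u N (Finsupp.single m₁ 1) * fock χ l u N (Finsupp.single m₂ 1) := by
  simp only [fock_single, one_smul]
  rw [smul_mul_smul_comm, Finset.sum_mul_sum]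
  simp only [shiftOp_mul, twist_pushSum]
  ext F γ
  have := sum_product_eval hC (fun x y => χ x y) l u (repF m₁) (repF m₂)
    (fun α : Fin N → G => shiftOp χ l α F γ)
  simp only [LinearMap.sum_apply, LinearMap.smul_apply, Finset.sum_apply, Pi.smul_apply,
    smul_eq_mul]
  rw [this, sub_eq_add_neg, zpow_add, Units.val_mul]

theorem fock_mulB {Cbar : AddSubmonoid G}
    (hC : ∀ x ∈ Cbar, ∀ y ∈ Cbar, x + y = 0 → x = 0 ∧ y = 0)
    (χ : G →+ G →+ ℤ) (l u : Λˣ) (N : ℕ) (f g : Multiset (Cpos Cbar) →₀ Λ) :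
    fock χ l u N (mulB (fun x y => χ x y) l u hC f g) = fock χ l u N f * fock χ l u N g := by
  have hexp : ∀ f : Multiset (Cpos Cbar) →₀ Λ,
      fock χ l u N f = f.sum fun m x => x • fock χ l u N (Finsupp.single m 1) := by
    intro f
    conv_lhs => rw [← Finsupp.sum_single f]
    rw [Finsupp.sum, map_sum]
    refine Finset.sum_congr rfl fun m _ => ?_
    dsimp only
    rw [← map_smul (fock χ l u N) (f m), Finsupp.smul_single, smul_eq_mul, mul_one]
  rw [hexp f, hexp g]
  simp only [mulB, Finsupp.sum, map_sum, Finset.sum_mul_sum]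
  refine Finset.sum_congr rfl fun m₁ _ => Finset.sum_congr rfl fun m₂ _ => ?_
  rw [smul_mul_smul_comm, ← fock_single_mul hC, Finset.smul_sum]
  refine Finset.sum_congr rfl fun m _ => ?_
  rw [smul_smul, ← map_smul, Finsupp.smul_single, smul_eq_mul, mul_one]

theorem fock_single_zero {Cbar : AddSubmonoid G} (χ : G →+ G →+ ℤ) (l u : Λˣ) (N : ℕ) :
    fock χ l u N (Finsupp.single (0 : Multiset (Cpos Cbar)) 1) = 1 := by
  rw [fock_single]
  have : ∀ h : Fin (Multiset.card (0 : Multiset (Cpos Cbar))) → Fin N,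
      pushSum (fun k => (repF (0 : Multiset (Cpos Cbar)) k : G)) h = 0 := by
    intro h
    ext y
    exact Finset.sum_eq_zero fun i _ => i.elim0
  simp only [this, shiftOp_zero]
  have : IsEmpty (Fin (Multiset.card (0 : Multiset (Cpos Cbar)))) :=
    inferInstanceAs (IsEmpty (Fin 0))
  rw [Finset.sum_const, Finset.card_univ, Fintype.card_unique]
  simp

theorem eq_of_pushSum_repF {Cbar : AddSubmonoid G} {m m' : Multiset (Cpos Cbar)}
    (hle : Multiset.card m' ≤ Multiset.card m) (h : Fin (Multiset.card m') → Fin (Multiset.card m))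
    (hh : pushSum (fun k => (repF m' k : G)) h = fun k => (repF m k : G)) : m' = m := by
  have hsurj : Function.Surjective h := by
    intro y
    by_contra hy
    push Not at hy
    apply (repF m y).2.2
    rw [← congrFun hh y, pushSum]
    exact Finset.sum_eq_zero fun i hi => absurd (Finset.mem_filter.1 hi).2 (hy i)
  have hcard : Multiset.card m' = Multiset.card m :=
    le_antisymm hle (by simpa using Fintype.card_le_of_surjective h hsurj)
  have hbij : Function.Bijective h :=
    (Fintype.bijective_iff_surjective_and_card h).2 ⟨hsurj, by simpa using hcard⟩
  have hrep : repF m ∘ h = repF m' := by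
    ext k
    rw [Function.comp_apply, ← congrFun hh (h k), pushSum_eq_sum_ite]
    simp [hbij.1.eq_iff]
  rw [← map_repF m', ← hrep, ← Multiset.map_map,
    show h = Equiv.ofBijective h hbij from rfl, Multiset.map_univ_val_equiv, map_repF]

theorem eq_zero_of_fock_eq_zero {Cbar : AddSubmonoid G} (χ : G →+ G →+ ℤ) (l u : Λˣ)
    (f : Multiset (Cpos Cbar) →₀ Λ) (hf : ∀ N, fock χ l u N f = 0) : f = 0 := by
  by_contra hne
  obtain ⟨m, hm, hmax⟩ := f.support.exists_max_image (fun m => Multiset.card m)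
    (Finsupp.support_nonempty_iff.2 hne)
  have h0 := congrFun (LinearMap.congr_fun (hf (Multiset.card m))
    (Pi.single (fun k => (repF m k : G)) 1)) 0
  have hcoef : ∀ (m' : Multiset (Cpos Cbar)) (h : Fin (Multiset.card m') → Fin (Multiset.card m)),
      shiftOp χ l (pushSum (fun k => (repF m' k : G)) h)
        (Pi.single (fun k => (repF m k : G)) (1 : Λ)) 0 =
      if pushSum (fun k => (repF m' k : G)) h = (fun k => (repF m k : G)) then 1 else 0 := by
    intro m' h
    simp [shiftOp_apply, twist, Pi.single_apply]
  rw [fock, Finsupp.linearCombination_apply, Finsupp.sum] at h0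
  simp only [LinearMap.sum_apply, LinearMap.smul_apply, Finset.sum_apply, Pi.smul_apply,
    smul_eq_mul, hcoef, LinearMap.zero_apply, Pi.zero_apply] at h0
  rw [Finset.sum_eq_single m] at h0
  · rw [Finset.sum_boole] at h0
    set s := Finset.univ.filter fun h : Fin (Multiset.card m) → Fin (Multiset.card m) =>
      pushSum (fun k => (repF m k : G)) h = (fun k => (repF m k : G)) with hs
    have hpos : (s.card : ℚ) ≠ 0 := by
      refine Nat.cast_ne_zero.2 (Finset.card_ne_zero_of_mem (a := id) ?_)
      rw [hs, Finset.mem_filter]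
      refine ⟨Finset.mem_univ _, ?_⟩
      ext k
      simp [pushSum_eq_sum_ite]
    have hunit : IsUnit (s.card : Λ) := by
      have := (IsUnit.mk0 _ hpos).map (algebraMap ℚ Λ)
      simpa using this
    rw [← mul_assoc, hunit.mul_left_eq_zero, Units.mul_left_eq_zero] at h0
    exact Finsupp.mem_support_iff.1 hm h0
  · intro m' hm' hne'
    rw [Finset.sum_eq_zero, mul_zero, mul_zero]
    intro h _
    exact if_neg fun hh => hne' (eq_of_pushSum_repF (hmax m' hm') h hh)
  · exact fun h => absurd hm h

theorem statement3
    (Cbar : AddSubmonoid G)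
    (hC : ∀ x ∈ Cbar, ∀ y ∈ Cbar, x + y = 0 → x = 0 ∧ y = 0)
    (χ : G → G → ℤ)
    (hχ₁ : ∀ x y z : G, χ (x + y) z = χ x z + χ y z)
    (hχ₂ : ∀ x y z : G, χ x (y + z) = χ x y + χ x z)
    (l u : Λˣ) (hl : ∀ k : ℕ, 0 < k → IsUnit ((l : Λ) ^ k - 1))
    (hu : (u : Λ) = (l : Λ) - 1) :
    (∀ f g h : Multiset (Cpos Cbar) →₀ Λ,
      mulB χ l u hC (mulB χ l u hC f g) h = mulB χ l u hC f (mulB χ l u hC g h)) ∧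
    (∀ f : Multiset (Cpos Cbar) →₀ Λ, mulB χ l u hC (Finsupp.single 0 1) f = f) ∧
    (∀ f : Multiset (Cpos Cbar) →₀ Λ, mulB χ l u hC f (Finsupp.single 0 1) = f) := by
  obtain ⟨χ, rfl⟩ : ∃ χ' : G →+ G →+ ℤ, χ = fun x y => χ' x y :=
    ⟨AddMonoidHom.mk' (fun x => AddMonoidHom.mk' (χ x) (hχ₂ x))
      (fun x y => AddMonoidHom.ext fun z => hχ₁ x y z), rfl⟩
  have hinj : ∀ f g : Multiset (Cpos Cbar) →₀ Λ,
      (∀ N, fock χ l u N f = fock χ l u N g) → f = g := by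
    intro f g h
    refine sub_eq_zero.1 (eq_zero_of_fock_eq_zero χ l u _ fun N => ?_)
    rw [map_sub, h N, sub_self]
  refine ⟨fun f g h => hinj _ _ fun N => ?_, fun f => hinj _ _ fun N => ?_,
    fun f => hinj _ _ fun N => ?_⟩
  · simp only [fock_mulB, mul_assoc]
  · rw [fock_mulB, fock_single_zero, one_mul]
  · rw [fock_mulB, fock_single_zero, mul_one]

end
end

section
/- Let g be the free Λ-module with basis formal symbols b^α for α ∈ C(𝒜), and define a Λ-bilinear bracket on g by [b^α, b^β] = ((ℓ^{−χ(β,α)} − ℓ^{−χ(α,β)})/(ℓ−1)) b^{α+β}. Then this bracket is alternating and satisfies the Jacobi identity, so it makes g into a Lie algebra over Λ. -/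
open Classical Function

noncomputable section

variable {G : Type} [AddCommGroup G] {Λ : Type} [CommRing Λ] [Algebra ℚ Λ]
  {Ω : Type} [CommRing Ω] [Algebra ℚ Ω]

/-- The bilinear bracket on the free `Λ`-module `g` with basis `b^α`, `α ∈ C(𝒜)`,
given on basis elements by `[b^α, b^β] = ((ℓ^{-χ(β,α)} - ℓ^{-χ(α,β)})/(ℓ-1)) b^{α+β}`. -/
def brkt {Cbar : AddSubmonoid G} (χ : G → G → ℤ) (l u : Λˣ)
    (hC : ∀ x ∈ Cbar, ∀ y ∈ Cbar, x + y = 0 → x = 0 ∧ y = 0)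
    (f g : Cpos Cbar →₀ Λ) : Cpos Cbar →₀ Λ :=
  f.sum fun α x => g.sum fun β y =>
    Finsupp.single (addC hC α β)
      (x * y *
        ((((l ^ (-χ (β : G) (α : G)) : Λˣ) : Λ) - ((l ^ (-χ (α : G) (β : G)) : Λˣ) : Λ))
          * ((u⁻¹ : Λˣ) : Λ)))

section BracketLemmas

variable {R : Type} [CommRing R] {Cbar : AddSubmonoid G} (χ : G → G → ℤ) (l u : Rˣ)
  (hC : ∀ x ∈ Cbar, ∀ y ∈ Cbar, x + y = 0 → x = 0 ∧ y = 0)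

theorem brkt_zero_left (g : Cpos Cbar →₀ R) : brkt χ l u hC 0 g = 0 := by
  simp [brkt]

theorem brkt_zero_right (f : Cpos Cbar →₀ R) : brkt χ l u hC f 0 = 0 := by
  simp [brkt]

theorem brkt_add_left (f₁ f₂ g : Cpos Cbar →₀ R) :
    brkt χ l u hC (f₁ + f₂) g = brkt χ l u hC f₁ g + brkt χ l u hC f₂ g := by
  unfold brkt
  refine Finsupp.sum_add_index' (fun α => by simp) fun α x₁ x₂ => ?_
  simp only [add_mul, Finsupp.single_add, Finsupp.sum_add]

theorem brkt_add_right (f g₁ g₂ : Cpos Cbar →₀ R) :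
    brkt χ l u hC f (g₁ + g₂) = brkt χ l u hC f g₁ + brkt χ l u hC f g₂ := by
  unfold brkt
  rw [← Finsupp.sum_add]
  refine Finsupp.sum_congr fun α _ => ?_
  refine Finsupp.sum_add_index' (fun β => by simp) fun β y₁ y₂ => ?_
  simp only [mul_add, add_mul, Finsupp.single_add]

theorem brkt_single_single (α β : Cpos Cbar) (x y : R) :
    brkt χ l u hC (Finsupp.single α x) (Finsupp.single β y) =
      Finsupp.single (addC hC α β)
        (x * y *
          ((((l ^ (-χ (β : G) (α : G)) : Rˣ) : R) - ((l ^ (-χ (α : G) (β : G)) : Rˣ) : R))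
            * ((u⁻¹ : Rˣ) : R))) := by
  unfold brkt
  rw [Finsupp.sum_single_index (by simp), Finsupp.sum_single_index (by simp)]

theorem addC_comm (α β : Cpos Cbar) : addC hC α β = addC hC β α :=
  Subtype.ext (add_comm _ _)

theorem addC_rotate (α β γ : Cpos Cbar) :
    addC hC (addC hC α β) γ = addC hC (addC hC β γ) α :=
  Subtype.ext (by simp only [addC]; abel)

theorem brkt_skew (f g : Cpos Cbar →₀ R) :
    brkt χ l u hC f g + brkt χ l u hC g f = 0 := by
  induction f using Finsupp.induction_linear with
  | zero => simp [brkt_zero_left, brkt_zero_right]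
  | add f₁ f₂ h₁ h₂ =>
    rw [brkt_add_left, brkt_add_right, add_add_add_comm, h₁, h₂, add_zero]
  | single α x =>
    induction g using Finsupp.induction_linear with
    | zero => simp [brkt_zero_left, brkt_zero_right]
    | add g₁ g₂ h₁ h₂ =>
      rw [brkt_add_left, brkt_add_right, add_add_add_comm, h₁, h₂, add_zero]
    | single β y =>
      rw [brkt_single_single, brkt_single_single, addC_comm hC β α, ← Finsupp.single_add]
      refine (congrArg _ ?_).trans (Finsupp.single_zero _)
      ring

theorem brkt_self (f : Cpos Cbar →₀ R) : brkt χ l u hC f f = 0 := by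
  induction f using Finsupp.induction_linear with
  | zero => exact brkt_zero_left χ l u hC 0
  | add f g hf hg =>
    rw [brkt_add_left, brkt_add_right, brkt_add_right, hf, hg, zero_add, add_zero, brkt_skew]
  | single α x => simp [brkt_single_single]

theorem brkt_jacobi_single
    (hχ₁ : ∀ x y z : G, χ (x + y) z = χ x z + χ y z)
    (hχ₂ : ∀ x y z : G, χ x (y + z) = χ x y + χ x z)
    (α β γ : Cpos Cbar) (x y z : R) :
    brkt χ l u hC (brkt χ l u hC (.single α x) (.single β y)) (.single γ z)
      + brkt χ l u hC (brkt χ l u hC (.single β y) (.single γ z)) (.single α x)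
      + brkt χ l u hC (brkt χ l u hC (.single γ z) (.single α x)) (.single β y) = 0 := by
  simp only [brkt_single_single]
  rw [addC_rotate hC γ α β, ← addC_rotate hC α β γ,
    ← Finsupp.single_add, ← Finsupp.single_add]
  refine (congrArg _ ?_).trans (Finsupp.single_zero _)
  simp only [addC, hχ₁, hχ₂, neg_add, zpow_add, Units.val_mul]
  ring

theorem brkt_jacobi
    (hχ₁ : ∀ x y z : G, χ (x + y) z = χ x z + χ y z)
    (hχ₂ : ∀ x y z : G, χ x (y + z) = χ x y + χ x z)
    (f g h : Cpos Cbar →₀ R) :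
    brkt χ l u hC (brkt χ l u hC f g) h + brkt χ l u hC (brkt χ l u hC g h) f
      + brkt χ l u hC (brkt χ l u hC h f) g = 0 := by
  have split {a₁ a₂ b₁ b₂ c₁ c₂ : Cpos Cbar →₀ R} (h₁ : a₁ + b₁ + c₁ = 0)
      (h₂ : a₂ + b₂ + c₂ = 0) : a₁ + a₂ + (b₁ + b₂) + (c₁ + c₂) = 0 := by
    rw [add_add_add_comm a₁, add_add_add_comm (a₁ + b₁), h₁, h₂, add_zero]
  induction f using Finsupp.induction_linear with
  | zero => simp [brkt_zero_left, brkt_zero_right]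
  | add f₁ f₂ h₁ h₂ =>
    simpa only [brkt_add_left, brkt_add_right] using split h₁ h₂
  | single α x =>
    induction g using Finsupp.induction_linear with
    | zero => simp [brkt_zero_left, brkt_zero_right]
    | add g₁ g₂ h₁ h₂ =>
      simpa only [brkt_add_left, brkt_add_right] using split h₁ h₂
    | single β y =>
      induction h using Finsupp.induction_linear with
      | zero => simp [brkt_zero_left, brkt_zero_right]
      | add g₁ g₂ h₁ h₂ =>
        simpa only [brkt_add_left, brkt_add_right] using split h₁ h₂
      | single γ z => exact brkt_jacobi_single χ l u hC hχ₁ hχ₂ α β γ x y z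

end BracketLemmas

theorem statement5
    (Cbar : AddSubmonoid G)
    (hC : ∀ x ∈ Cbar, ∀ y ∈ Cbar, x + y = 0 → x = 0 ∧ y = 0)
    (χ : G → G → ℤ)
    (hχ₁ : ∀ x y z : G, χ (x + y) z = χ x z + χ y z)
    (hχ₂ : ∀ x y z : G, χ x (y + z) = χ x y + χ x z)
    (l u : Λˣ) (hl : ∀ k : ℕ, 0 < k → IsUnit ((l : Λ) ^ k - 1))
    (hu : (u : Λ) = (l : Λ) - 1) :
    (∀ f : Cpos Cbar →₀ Λ, brkt χ l u hC f f = 0) ∧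
    (∀ f g h : Cpos Cbar →₀ Λ,
      brkt χ l u hC (brkt χ l u hC f g) h + brkt χ l u hC (brkt χ l u hC g h) f
        + brkt χ l u hC (brkt χ l u hC h f) g = 0) := by
  exact ⟨brkt_self χ l u hC, brkt_jacobi χ l u hC hχ₁ hχ₂⟩

end
end

section
/- For all equivalence classes [I,κ], [J,λ] and [K,μ], the coefficient of b_{[K,μ]} in b_{[I,κ]} ⋆ b_{[J,λ]} as defined by equation (6.14) equals (1/|Aut(K,μ)|) · Σ_{(η,ζ)} Π_{k∈K} [ (ℓ−1)^{1−|η^{−1}(k)|−|ζ^{−1}(k)|} · Σ_{L_k} ((−1)^{|L_k|−1}/|L_k|) Σ_{(φ_k,ψ_k)} Π_{i ∈ η^{−1}(k), j ∈ ζ^{−1}(k) with φ_k(i)=ψ_k(j)} ℓ^{−χ(λ(j),κ(i))} ], where (η,ζ) runs over pairs of maps η : I → K, ζ : J → K with μ(k) = κ(η^{−1}(k)) + λ(ζ^{−1}(k)) for all k ∈ K, L_k runs over one representative of each isomorphism class of nonempty finite sets, and (φ_k,ψ_k) runs over pairs of maps φ_k : η^{−1}(k) → L_k, ψ_k : ζ^{−1}(k)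 → L_k with φ_k ⊔ ψ_k surjective (this is equation (6.22)). -/
open Classical Function

noncomputable section

variable {G : Type} [AddCommGroup G] {Λ : Type} [CommRing Λ] [Algebra ℚ Λ]
  {Ω : Type} [CommRing Ω] [Algebra ℚ Ω]

theorem card_fiberCard_eq_multinomial {n c : ℕ} (m : Fin c → ℕ)
    (hm : m ∈ Finset.piAntidiag (Finset.univ : Finset (Fin c)) n) :
    (Finset.univ.filter (fun θ : Fin n → Fin c =>
      (fun k => (Finset.univ.filter (fun x => θ x = k)).card) = m)).card =
      Nat.multinomial Finset.univ m := by
  have h := Finset.sum_pow_eq_sum_piAntidiag (R := MvPolynomial (Fin c) ℕ) Finset.univ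
    (fun k => MvPolynomial.X k) n
  have h2 : (∑ k : Fin c, (MvPolynomial.X k : MvPolynomial (Fin c) ℕ)) ^ n =
      ∑ θ : Fin n → Fin c, ∏ k, MvPolynomial.X k ^
        (Finset.univ.filter (fun x => θ x = k)).card := by
    rw [Finset.sum_pow', Fintype.piFinset_univ]
    refine Finset.sum_congr rfl fun θ _ => ?_
    rw [← Finset.prod_fiberwise (s := Finset.univ) (g := θ)]
    refine Finset.prod_congr rfl fun k _ => ?_
    rw [← Finset.prod_const]
    exact Finset.prod_congr rfl fun x hx => by rw [(Finset.mem_filter.1 hx).2]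
  have key : ∀ f : Fin c → ℕ, (∏ k, (MvPolynomial.X k : MvPolynomial (Fin c) ℕ) ^ f k) =
      MvPolynomial.monomial (Finsupp.equivFunOnFinite.symm f) 1 := by
    intro f
    rw [MvPolynomial.monomial_eq, Finsupp.prod_fintype _ _ (by simp)]
    simp
  rw [h2] at h
  have h3 := congrArg (MvPolynomial.coeff (Finsupp.equivFunOnFinite.symm m)) h
  have h4 : ∀ (x : ℕ) (p : MvPolynomial (Fin c) ℕ), (x : MvPolynomial (Fin c) ℕ) * p =
    MvPolynomial.C x * p := by intro x p; simp
  simp only [key, h4, MvPolynomial.coeff_sum, MvPolynomial.coeff_C_mul, MvPolynomial.coeff_monomial,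
    EmbeddingLike.apply_eq_iff_eq, mul_ite, mul_one, mul_zero] at h3
  rw [Finset.sum_ite_eq_of_mem' _ _ _ hm] at h3
  rw [← h3, Finset.card_filter]

theorem sum_comp_fiberCard {R : Type} [CommSemiring R] {n c : ℕ} (F : (Fin c → ℕ) → R) :
    ∑ θ : Fin n → Fin c, F (fun k => (Finset.univ.filter (fun x => θ x = k)).card) =
      ∑ m ∈ Finset.piAntidiag (Finset.univ : Finset (Fin c)) n,
        (Nat.multinomial Finset.univ m : R) * F m := by
  rw [← Finset.sum_fiberwise_of_maps_to
    (t := Finset.piAntidiag (Finset.univ : Finset (Fin c)) n)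
    (g := fun (θ : Fin n → Fin c) k => (Finset.univ.filter (fun x => θ x = k)).card)]
  · refine Finset.sum_congr rfl fun m hm => ?_
    rw [← card_fiberCard_eq_multinomial m hm, ← nsmul_eq_mul, ← Finset.sum_const]
    exact Finset.sum_congr rfl fun θ hθ => by rw [(Finset.mem_filter.1 hθ).2]
  · intro θ _
    rw [Finset.mem_piAntidiag]
    refine ⟨?_, by simp⟩
    rw [← Finset.card_eq_sum_card_fiberwise (by simp)]
    simp

/-- The sum of `∏ w i j` over `φ i = ψ j`, over all jointly surjective `φ : A → L`, `ψ : B → L`. -/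
def surjSum {R : Type} [CommSemiring R] {A B : Type} (L : Type)
    [DecidableEq A] [DecidableEq B] [DecidableEq L]
    [Fintype A] [Fintype B] [Fintype L] (w : A → B → R) : R :=
  ∑ p ∈ Finset.univ.filter
      (fun p : (A → L) × (B → L) => Surjective (Sum.elim p.1 p.2)),
    ∏ q ∈ Finset.univ.filter (fun q : A × B => p.1 q.1 = p.2 q.2), w q.1 q.2

theorem surjSum_congr {R : Type} [CommSemiring R] {A B L L' : Type}
    [DecidableEq A] [DecidableEq B] [DecidableEq L] [DecidableEq L']
    [Fintype A] [Fintype B] [Fintype L] [Fintype L']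
    (e : L ≃ L') (w : A → B → R) : surjSum L w = surjSum L' w := by
  refine Finset.sum_equiv ((Equiv.arrowCongr (Equiv.refl A) e).prodCongr
    (Equiv.arrowCongr (Equiv.refl B) e)) ?_ ?_
  · rintro ⟨φ, ψ⟩
    have : Sum.elim (e ∘ φ) (e ∘ ψ) = e ∘ Sum.elim φ ψ := by
      ext (i | j) <;> rfl
    simp [Equiv.arrowCongr, this]
  · rintro ⟨φ, ψ⟩ _
    simp [Equiv.arrowCongr]

theorem surjSum_eq_zero {R : Type} [CommSemiring R] {A B L : Type}
    [DecidableEq A] [DecidableEq B] [DecidableEq L]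
    [Fintype A] [Fintype B] [Fintype L] (w : A → B → R)
    (h : Fintype.card A + Fintype.card B < Fintype.card L) : surjSum L w = 0 := by
  refine Finset.sum_eq_zero fun p hp => ?_
  have := Fintype.card_le_of_surjective _ (Finset.mem_filter.1 hp).2
  rw [Fintype.card_sum] at this
  omega

theorem surjSum_empty {R : Type} [CommSemiring R] {A B L : Type}
    [DecidableEq A] [DecidableEq B] [DecidableEq L]
    [Fintype A] [Fintype B] [Fintype L] [IsEmpty L]
    (w : A → B → R) (h : Nonempty (A ⊕ B)) : surjSum L w = 0 := by
  refine Finset.sum_eq_zero fun p hp => ?_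
  exact isEmptyElim (Sum.elim p.1 p.2 h.some)

theorem prod_surjSum_fiber {R : Type} [CommSemiring R] {A B L K : Type}
    [DecidableEq A] [DecidableEq B] [DecidableEq L] [DecidableEq K]
    [Fintype A] [Fintype B] [Fintype L] [Fintype K]
    (w : A → B → R) (η : A → K) (ζ : B → K) (θ : L → K) :
    ∏ k, surjSum {x // θ x = k}
        (fun (i : {i // η i = k}) (j : {j // ζ j = k}) => w i j) =
      ∑ p ∈ Finset.univ.filter (fun p : (A → L) × (B → L) =>
          Surjective (Sum.elim p.1 p.2) ∧ θ ∘ p.1 = η ∧ θ ∘ p.2 = ζ),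
        ∏ q ∈ Finset.univ.filter (fun q : A × B => p.1 q.1 = p.2 q.2), w q.1 q.2 := by
  unfold surjSum
  rw [Finset.prod_univ_sum]
  symm
  refine Finset.sum_bij'
    (fun p hp k =>
      (fun i => ⟨p.1 i, (congrFun (Finset.mem_filter.1 hp).2.2.1 i).trans i.2⟩,
       fun j => ⟨p.2 j, (congrFun (Finset.mem_filter.1 hp).2.2.2 j).trans j.2⟩))
    (fun p _ => (fun i => (p (η i)).1 ⟨i, rfl⟩, fun j => (p (ζ j)).2 ⟨j, rfl⟩)) ?_ ?_ ?_ ?_ ?_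
  · intro p hp
    obtain ⟨-, hs, h1, h2⟩ := Finset.mem_filter.1 hp
    simp only [Fintype.mem_piFinset, Finset.mem_filter, Finset.mem_univ, true_and]
    rintro k ⟨x, rfl⟩
    obtain ⟨i | j, rfl⟩ := hs x
    · exact ⟨Sum.inl ⟨i, (congrFun h1 i).symm⟩, rfl⟩
    · exact ⟨Sum.inr ⟨j, (congrFun h2 j).symm⟩, rfl⟩
  · intro p hp
    simp only [Fintype.mem_piFinset, Finset.mem_filter, Finset.mem_univ, true_and] at hp ⊢
    refine ⟨fun x => ?_, funext fun i => ((p (η i)).1 ⟨i, rfl⟩).2,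
      funext fun j => ((p (ζ j)).2 ⟨j, rfl⟩).2⟩
    have h1 : ∀ i k (hi : η i = k), ((p k).1 ⟨i, hi⟩ : L) = (p (η i)).1 ⟨i, rfl⟩ := by
      rintro i _ rfl; rfl
    have h2 : ∀ j k (hj : ζ j = k), ((p k).2 ⟨j, hj⟩ : L) = (p (ζ j)).2 ⟨j, rfl⟩ := by
      rintro j _ rfl; rfl
    obtain ⟨⟨i, hi⟩ | ⟨j, hj⟩, h⟩ := hp (θ x) ⟨x, rfl⟩
    · exact ⟨Sum.inl i, (h1 i _ hi).symm.trans (congrArg Subtype.val h)⟩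
    · exact ⟨Sum.inr j, (h2 j _ hj).symm.trans (congrArg Subtype.val h)⟩
  · intro p hp
    rfl
  · intro p hp
    funext k
    refine Prod.ext (funext ?_) (funext ?_)
    · rintro ⟨i, rfl⟩; rfl
    · rintro ⟨j, rfl⟩; rfl
  · intro p hp
    obtain ⟨-, hs, h1, h2⟩ := Finset.mem_filter.1 hp
    rw [← Finset.prod_fiberwise (s := Finset.univ.filter _) (g := fun q => η q.1)]
    refine Finset.prod_congr rfl fun k _ => ?_
    symm
    refine Finset.prod_nbij (fun q => (q.1.1, q.2.1)) ?_ ?_ ?_ ?_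
    · rintro ⟨⟨i, hi⟩, ⟨j, hj⟩⟩ hq
      simpa [hi] using hq
    · rintro ⟨⟨i, hi⟩, ⟨j, hj⟩⟩ _ ⟨⟨i', hi'⟩, ⟨j', hj'⟩⟩ _ h
      simpa using h
    · rintro ⟨i, j⟩ hq
      simp only [Finset.coe_filter, Finset.mem_filter, Finset.mem_univ, true_and,
        Set.mem_ofPred_eq] at hq
      refine ⟨(⟨i, hq.2⟩, ⟨j, ?_⟩), ?_, rfl⟩
      · rw [← hq.2, ← congrFun h1 i, ← congrFun h2 j]; exact congrArg θ hq.1.symm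
      · simpa using hq.1
    · intros; rfl

theorem sum_sum_filter_comp {R : Type} [CommSemiring R] {A B L K : Type}
    [DecidableEq A] [DecidableEq B] [DecidableEq L] [DecidableEq K]
    [Fintype A] [Fintype B] [Fintype L] [Fintype K]
    (P : (A → K) × (B → K) → Prop)
    (f : (L → K) → R) (g : (A → L) × (B → L) → R)
    (hP : ∀ r, P r → Surjective (Sum.elim r.1 r.2)) :
    ∑ t ∈ Finset.univ.filter (fun t : (A → L) × (B → L) × (L → K) =>
        Surjective (Sum.elim t.1 t.2.1) ∧ Surjective t.2.2 ∧ P (t.2.2 ∘ t.1, t.2.2 ∘ t.2.1)),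
      f t.2.2 * g (t.1, t.2.1) =
    ∑ r ∈ Finset.univ.filter P, ∑ θ : L → K, f θ *
      ∑ p ∈ Finset.univ.filter (fun p : (A → L) × (B → L) =>
        Surjective (Sum.elim p.1 p.2) ∧ θ ∘ p.1 = r.1 ∧ θ ∘ p.2 = r.2), g p := by
  simp only [Finset.mul_sum]
  rw [← Finset.sum_fiberwise_of_maps_to (t := Finset.univ.filter P)
    (g := fun t : (A → L) × (B → L) × (L → K) => (t.2.2 ∘ t.1, t.2.2 ∘ t.2.1))]
  · refine Finset.sum_congr rfl fun r hr => ?_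
    have hr' := hP r (Finset.mem_filter.1 hr).2
    rw [Finset.sum_sigma']
    refine Finset.sum_bij' (fun t _ => ⟨t.2.2, (t.1, t.2.1)⟩)
      (fun s _ => (s.2.1, s.2.2, s.1)) ?_ ?_ ?_ ?_ ?_
    · rintro ⟨φ, ψ, θ⟩ h
      simp only [Finset.mem_filter, Finset.mem_univ, true_and, Finset.mem_sigma] at h ⊢
      exact ⟨h.1.1, congrArg Prod.fst h.2, congrArg Prod.snd h.2⟩
    · rintro ⟨θ, φ, ψ⟩ h
      simp only [Finset.mem_filter, Finset.mem_univ, true_and, Finset.mem_sigma] at h hr ⊢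
      obtain ⟨h0, h1, h2⟩ := h
      refine ⟨⟨h0, ?_, ?_⟩, Prod.ext h1 h2⟩
      · intro k
        obtain ⟨i | j, rfl⟩ := hr' k
        · exact ⟨φ i, congrFun h1 i⟩
        · exact ⟨ψ j, congrFun h2 j⟩
      · rw [h1, h2]; exact hr
    · intros; rfl
    · intros; rfl
    · intros; rfl
  · intro t ht
    simp only [Finset.mem_filter, Finset.mem_univ, true_and] at ht ⊢
    exact ht.2.2

theorem signed_multinomial_eq_prod {c : ℕ} (m : Fin c → ℕ) (hm : ∀ k, m k ≠ 0) :
    (-1 : ℚ) ^ ((∑ k, m k) + c) / ((∑ k, m k).factorial : ℚ) *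
      (Nat.multinomial Finset.univ m * ∏ k, ((m k - 1).factorial : ℚ)) =
    ∏ k, (-1 : ℚ) ^ (m k + 1) / (m k : ℚ) := by
  have h := Nat.multinomial_spec Finset.univ m
  have h2 : ∀ k, ((m k).factorial : ℚ) = m k * ((m k - 1).factorial : ℚ) := by
    intro k
    exact_mod_cast (Nat.mul_factorial_pred (hm k)).symm
  have h3 : (∏ k, (m k : ℚ)) * (∏ k, ((m k - 1).factorial : ℚ)) * Nat.multinomial Finset.univ m =
      ((∑ k, m k).factorial : ℚ) := by
    rw [← h, ← Finset.prod_mul_distrib]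
    push_cast
    simp only [h2]
  have h4 : (∏ k, (m k : ℚ)) ≠ 0 := Finset.prod_ne_zero_iff.2 fun k _ => by exact_mod_cast hm k
  have h5 : ((∑ k, m k).factorial : ℚ) ≠ 0 := by positivity
  have h6 : ∏ k, (-1 : ℚ) ^ (m k + 1) = (-1) ^ ((∑ k, m k) + c) := by
    rw [Finset.prod_pow_eq_pow_sum, Finset.sum_add_distrib]
    simp
  rw [Finset.prod_div_distrib, h6, div_mul_eq_mul_div, div_eq_div_iff h5 h4, ← h3]
  ring

theorem sum_multinomial_eq_prod_sum {R : Type} [CommRing R] [Algebra ℚ R] {c : ℕ}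
    (S : Fin c → ℕ → R) (d : Fin c → ℕ)
    (h0 : ∀ k, S k 0 = 0) (hd : ∀ k n, d k < n → S k n = 0) :
    ∑ n ∈ Finset.range ((∑ k, d k) + 1),
      algebraMap ℚ R ((-1 : ℚ) ^ (n + c) / (n.factorial : ℚ)) *
        ∑ m ∈ Finset.piAntidiag (Finset.univ : Finset (Fin c)) n,
          (Nat.multinomial Finset.univ m : R) *
            (algebraMap ℚ R (∏ k, ((m k - 1).factorial : ℚ)) * ∏ k, S k (m k)) =
    ∏ k, ∑ n ∈ Finset.Icc 1 (∑ k, d k),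
      algebraMap ℚ R ((-1 : ℚ) ^ (n + 1) / (n : ℚ)) * S k n := by
  set N := ∑ k, d k
  rw [Finset.prod_univ_sum]
  set H : (Fin c → ℕ) → R := fun m =>
    ∏ k, (algebraMap ℚ R ((-1 : ℚ) ^ (m k + 1) / (m k : ℚ)) * S k (m k)) with hH
  have hH0 : ∀ m, (∃ k, S k (m k) = 0) → H m = 0 := by
    rintro m ⟨k, hk⟩
    exact Finset.prod_eq_zero (Finset.mem_univ k) (by rw [hk, mul_zero])
  have hterm : ∀ n, ∀ m ∈ Finset.piAntidiag (Finset.univ : Finset (Fin c)) n,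
      algebraMap ℚ R ((-1 : ℚ) ^ (n + c) / (n.factorial : ℚ)) *
        ((Nat.multinomial Finset.univ m : R) *
          (algebraMap ℚ R (∏ k, ((m k - 1).factorial : ℚ)) * ∏ k, S k (m k))) = H m := by
    intro n m hm
    obtain ⟨rfl, -⟩ := Finset.mem_piAntidiag.1 hm
    by_cases hz : ∃ k, m k = 0
    · obtain ⟨k, hk⟩ := hz
      have hk' : S k (m k) = 0 := by rw [hk, h0]
      rw [hH0 m ⟨k, hk'⟩, Finset.prod_eq_zero (f := fun k => S k (m k)) (Finset.mem_univ k) hk']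
      simp
    · push Not at hz
      rw [hH]
      simp only [Finset.prod_mul_distrib]
      rw [← map_prod, ← signed_multinomial_eq_prod m hz, map_mul, map_mul, map_natCast]
      ring
  simp only [Finset.mul_sum]
  rw [Finset.sum_congr rfl fun n _ => Finset.sum_congr rfl (hterm n)]
  have hle : ∀ m : Fin c → ℕ, ∀ k, m k ≤ ∑ k, m k := fun m k =>
    Finset.single_le_sum (fun _ _ => Nat.zero_le _) (Finset.mem_univ k)
  have hfib : ∑ n ∈ Finset.range (N + 1), ∑ m ∈ Finset.piAntidiag Finset.univ n, H m =
      ∑ m ∈ (Fintype.piFinset fun _ : Fin c => Finset.range (N + 1)).filter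
        (fun m => ∑ k, m k ∈ Finset.range (N + 1)), H m := by
    rw [← Finset.sum_fiberwise_of_maps_to (t := Finset.range (N + 1))
      (g := fun m : Fin c → ℕ => ∑ k, m k)
      (fun m hm => (Finset.mem_filter.1 hm).2)]
    refine Finset.sum_congr rfl fun n hn => Finset.sum_congr ?_ fun _ _ => rfl
    ext m
    simp only [Finset.mem_piAntidiag, Finset.mem_filter, Fintype.mem_piFinset, Finset.mem_range,
      Finset.mem_univ, implies_true, and_true] at hn ⊢
    refine ⟨?_, And.right⟩
    rintro rfl
    exact ⟨⟨fun k => (hle m k).trans_lt hn, hn⟩, rfl⟩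
  rw [hfib, Finset.sum_subset (Finset.filter_subset _ _)]
  · symm
    refine Finset.sum_subset (Fintype.piFinset_subset _ _ fun k x hx => ?_) fun m hm hm' => ?_
    · simp only [Finset.mem_Icc, Finset.mem_range] at hx ⊢; omega
    · simp only [Fintype.mem_piFinset, Finset.mem_range, Finset.mem_Icc, not_forall] at hm hm'
      obtain ⟨k, hk⟩ := hm'
      have : m k = 0 := by have := hm k; omega
      exact hH0 m ⟨k, by rw [this, h0]⟩
  · intro m hm hm'
    apply hH0
    by_contra! hne
    refine hm' (Finset.mem_filter.2 ⟨hm, Finset.mem_range.2 (Nat.lt_succ_of_le ?_)⟩)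
    exact Finset.sum_le_sum fun k _ => not_lt.1 fun h => hne k (hd k _ h)

theorem sum_card_fiber_add {a b c : ℕ} (η : Fin a → Fin c) (ζ : Fin b → Fin c) :
    ∑ k, (Fintype.card {i // η i = k} + Fintype.card {j // ζ j = k}) = a + b := by
  rw [Finset.sum_add_distrib]
  simp only [Fintype.card_subtype]
  rw [← Finset.card_eq_sum_card_fiberwise (by simp), ← Finset.card_eq_sum_card_fiberwise (by simp)]
  simp

theorem prod_zpow_fiber {M : Type} [CommGroup M] (u : M) {a b c : ℕ}
    (η : Fin a → Fin c) (ζ : Fin b → Fin c) :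
    ∏ k, u ^ (1 - ((Finset.univ.filter (fun i => η i = k)).card : ℤ)
      - ((Finset.univ.filter (fun j => ζ j = k)).card : ℤ)) = u ^ ((c : ℤ) - a - b) := by
  have h := sum_card_fiber_add η ζ
  simp only [Fintype.card_subtype] at h
  have h' : ∑ k, (((Finset.univ.filter (fun i => η i = k)).card : ℤ) +
      ((Finset.univ.filter (fun j => ζ j = k)).card : ℤ)) = a + b := by exact_mod_cast h
  have hp : ∀ f : Fin c → ℤ, ∏ k, u ^ f k = u ^ ∑ k, f k := fun f =>
    (map_prod (zpowersHom M u) (fun k => Multiplicative.ofAdd (f k)) Finset.univ).symm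
  rw [hp]
  congr 1
  simp only [sub_sub, Finset.sum_sub_distrib, h']
  simp

theorem statement11
    (Cbar : AddSubmonoid G)
    (hC : ∀ x ∈ Cbar, ∀ y ∈ Cbar, x + y = 0 → x = 0 ∧ y = 0)
    (χ : G → G → ℤ)
    (hχ₁ : ∀ x y z : G, χ (x + y) z = χ x z + χ y z)
    (hχ₂ : ∀ x y z : G, χ x (y + z) = χ x y + χ x z)
    (l u : Λˣ) (hl : ∀ k : ℕ, 0 < k → IsUnit ((l : Λ) ^ k - 1))
    (hu : (u : Λ) = (l : Λ) - 1) :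
    ∀ (a b c : ℕ) (κ : Fin a → Cpos Cbar) (lam : Fin b → Cpos Cbar) (μ : Fin c → Cpos Cbar),
      coeff614 χ l u κ lam μ
        = algebraMap ℚ Λ ((autCard μ : ℚ))⁻¹ *
            ∑ ηζ ∈ Finset.univ.filter
                (fun ηζ : (Fin a → Fin c) × (Fin b → Fin c) =>
                  ∀ k : Fin c,
                    (μ k : G) =
                      (∑ i ∈ Finset.univ.filter (fun i : Fin a => ηζ.1 i = k), ((κ i : G))) +
                        ∑ j ∈ Finset.univ.filter (fun j : Fin b => ηζ.2 j = k), ((lam j : G))),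
              ∏ k : Fin c,
                (((u ^ (1 - ((Finset.univ.filter (fun i : Fin a => ηζ.1 i = k)).card : ℤ)
                          - ((Finset.univ.filter (fun j : Fin b => ηζ.2 j = k)).card : ℤ)) : Λˣ) : Λ) *
                  ∑ n ∈ Finset.Icc 1 (a + b),
                    algebraMap ℚ Λ ((-1 : ℚ) ^ (n + 1) / (n : ℚ)) *
                      ∑ φψ ∈ Finset.univ.filter
                          (fun φψ : ({i : Fin a // ηζ.1 i = k} → Fin n) ×
                              ({j : Fin b // ηζ.2 j = k} → Fin n) =>
                            Function.Surjective (Sum.elim φψ.1 φψ.2)),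
                        ∏ q ∈ Finset.univ.filter
                            (fun q : {i : Fin a // ηζ.1 i = k} × {j : Fin b // ηζ.2 j = k} =>
                              φψ.1 q.1 = φψ.2 q.2),
                          ((l ^ (-χ ((lam q.2.1 : G)) ((κ q.1.1 : G))) : Λˣ) : Λ)) := by
  intro a b c κ lam μ
  set w : Fin a → Fin b → Λ := fun i j => ((l ^ (-χ (lam j : G) (κ i : G)) : Λˣ) : Λ)
  set P : (Fin a → Fin c) × (Fin b → Fin c) → Prop := fun r => ∀ k : Fin c, (μ k : G) =
    (∑ i ∈ Finset.univ.filter (fun i : Fin a => r.1 i = k), ((κ i : G))) +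
      ∑ j ∈ Finset.univ.filter (fun j : Fin b => r.2 j = k), ((lam j : G))
  have hP : ∀ r, P r → Surjective (Sum.elim r.1 r.2) := by
    intro r hr k
    by_contra hne
    refine (μ k).2.2 ?_
    rw [hr k, Finset.filter_false_of_mem, Finset.filter_false_of_mem]
    · simp
    · exact fun j _ hj => hne ⟨Sum.inr j, hj⟩
    · exact fun i _ hi => hne ⟨Sum.inl i, hi⟩
  have hsum : ∀ n : ℕ, _ := fun n => sum_sum_filter_comp (L := Fin n) P
    (fun θ => algebraMap ℚ Λ (∏ k : Fin c,
      (((Finset.univ.filter (fun x : Fin n => θ x = k)).card - 1).factorial : ℚ)))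
    (fun p => ∏ q ∈ Finset.univ.filter (fun q : Fin a × Fin b => p.1 q.1 = p.2 q.2), w q.1 q.2) hP
  have hinner : ∀ (n : ℕ) (r : (Fin a → Fin c) × (Fin b → Fin c)),
      ∑ θ : Fin n → Fin c, algebraMap ℚ Λ (∏ k : Fin c,
        (((Finset.univ.filter (fun x : Fin n => θ x = k)).card - 1).factorial : ℚ)) *
      ∑ p ∈ Finset.univ.filter (fun p : (Fin a → Fin n) × (Fin b → Fin n) =>
        Surjective (Sum.elim p.1 p.2) ∧ θ ∘ p.1 = r.1 ∧ θ ∘ p.2 = r.2),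
        ∏ q ∈ Finset.univ.filter (fun q : Fin a × Fin b => p.1 q.1 = p.2 q.2), w q.1 q.2 =
      ∑ m ∈ Finset.piAntidiag (Finset.univ : Finset (Fin c)) n,
        (Nat.multinomial Finset.univ m : Λ) *
          (algebraMap ℚ Λ (∏ k, ((m k - 1).factorial : ℚ)) *
            ∏ k, surjSum (Fin (m k))
              (fun (i : {i // r.1 i = k}) (j : {j // r.2 j = k}) => w i j)) := by
    intro n r
    rw [← sum_comp_fiberCard (fun m => algebraMap ℚ Λ (∏ k, ((m k - 1).factorial : ℚ)) *
            ∏ k, surjSum (Fin (m k))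
              (fun (i : {i // r.1 i = k}) (j : {j // r.2 j = k}) => w i j))]
    refine Finset.sum_congr rfl fun θ _ => ?_
    have := prod_surjSum_fiber w r.1 r.2 θ
    congr 1
    convert this.symm.trans (Finset.prod_congr rfl fun k _ => surjSum_congr
      (Fintype.equivFinOfCardEq (Fintype.card_subtype _)) _)
  unfold coeff614
  have hL : ∀ n, ∑ t ∈ Finset.univ.filter
            (fun t : (Fin a → Fin n) × (Fin b → Fin n) × (Fin n → Fin c) =>
              Function.Surjective (Sum.elim t.1 t.2.1) ∧
              Function.Surjective t.2.2 ∧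
              ∀ k : Fin c,
                (μ k : G) =
                  (∑ i ∈ Finset.univ.filter (fun i : Fin a => t.2.2 (t.1 i) = k),
                    ((κ i : G))) +
                  ∑ j ∈ Finset.univ.filter (fun j : Fin b => t.2.2 (t.2.1 j) = k),
                    ((lam j : G))),
          algebraMap ℚ Λ
              (∏ k : Fin c,
                (((Finset.univ.filter (fun x : Fin n => t.2.2 x = k)).card - 1).factorial : ℚ)) *
            ∏ q ∈ Finset.univ.filter (fun q : Fin a × Fin b => t.1 q.1 = t.2.1 q.2),
              ((l ^ (-χ ((lam q.2 : G)) ((κ q.1 : G))) : Λˣ) : Λ) =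
      ∑ r ∈ Finset.univ.filter P, ∑ m ∈ Finset.piAntidiag (Finset.univ : Finset (Fin c)) n,
        (Nat.multinomial Finset.univ m : Λ) *
          (algebraMap ℚ Λ (∏ k, ((m k - 1).factorial : ℚ)) *
            ∏ k, surjSum (Fin (m k))
              (fun (i : {i // r.1 i = k}) (j : {j // r.2 j = k}) => w i j)) := by
    intro n
    rw [← Finset.sum_congr rfl fun r _ => hinner n r]
    convert hsum n <;> rfl
  rw [Finset.sum_congr rfl fun n _ => by rw [hL n]]
  simp only [Finset.mul_sum (Finset.univ.filter P)]
  rw [Finset.sum_comm]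
  rw [Finset.mul_sum, Finset.mul_sum]
  refine Finset.sum_congr (by congr) fun r hr => ?_
  have hS := sum_multinomial_eq_prod_sum
    (fun k n => surjSum (Fin n) (fun (i : {i // r.1 i = k}) (j : {j // r.2 j = k}) => w i j))
    (fun k => Fintype.card {i // r.1 i = k} + Fintype.card {j // r.2 j = k})
    (fun k => surjSum_empty _ ?_)
    (fun k n h => surjSum_eq_zero _ (by simpa using h))
  · rw [sum_card_fiber_add] at hS
    rw [hS, Finset.prod_mul_distrib, ← Units.coe_prod, prod_zpow_fiber, mul_comm (Units.val _),
      mul_assoc]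
    refine congrArg _ (congrArg _ (Finset.prod_congr rfl fun k _ =>
      Finset.sum_congr rfl fun n _ => ?_))
    rfl
  · obtain ⟨i | j, h⟩ := hP r (Finset.mem_filter.1 hr).2 k
    · exact ⟨Sum.inl ⟨i, h⟩⟩
    · exact ⟨Sum.inr ⟨j, h⟩⟩

end
end
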